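/- Let H be a Hamiltonian on [a,b) such that neither h1 nor h2 vanishes a.e. on any neighbourhood of a, let f : (0,∞) → (0,∞) be a continuous, non-decreasing, regularly varying function, and let μ_H be the spectral measure of H. Consider the statements: (i) there exists a' ∈ (a,b) with ∫_a^{a'} h1(t)·f((m1·m2)(t)^{−1/2}) dt < ∞; (ii) ∫_1^∞ μ_H↔(r)·f(r)/r³ dr < ∞; (iii) there exists a' ∈ (a,b) with ∫_a^{a'} (1/m2(t)²)·(m2(t), −m3(t))·H(t)·(m2(t), −m3(t))ᵀ · f((m1·m2)(t)^{−1/2}) dt < ∞. Then (i) ⟹ (ii) ⟹ (iii). If in addition f is differentiable and f' is regularly varying, then (i) is equivalent to the existence of a' ∈ (a,b) with ∫_a^{a'} m1(t)·f'((m1·m2)(t)^{−1/2})·(m1·m2)'(t)/(m1·m2)(t)^{3/2} dt < ∞, and (iii) is equivalent to the existence of a' ∈ (a,b) with ∫_a^{a'} (det M(t)/m2(t))·f'((m1·m2)(t)^{−1/2})·(m1·m2)'(t)/(m1·m2)(t)^{3/2} dt < ∞. -/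

import Mathlib

open MeasureTheory Filter Topology Matrix Set
open scoped ENNReal

noncomputable section

/-- The symplectic matrix `J = [[0,-1],[1,0]]` (real version). -/
def Jmat : Matrix (Fin 2) (Fin 2) ℝ := !![0, -1; 1, 0]

/-- The symplectic matrix `J` (complex version). -/
def JmatC : Matrix (Fin 2) (Fin 2) ℂ := !![0, -1; 1, 0]

/-- `|J| = [[0,1],[1,0]]`. -/
def Jabs : Matrix (Fin 2) (Fin 2) ℝ := !![0, 1; 1, 0]

/-- The entrywise comparison `|U| ⪯ V`. -/
def entryAbsLe (U V : Matrix (Fin 2) (Fin 2) ℝ) : Prop :=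
  ∀ i j, |U i j| ≤ V i j

/-- The filter describing `t → b⁻`, `t` ranging over the reals, `b : EReal`. -/
def toBFilter (b : EReal) : Filter ℝ :=
  Filter.comap (fun t : ℝ => (t : EReal)) (nhdsWithin b (Set.Iio b))

/-- `H` is a Hamiltonian on `[a, b)`. -/
structure IsHamiltonian (a : ℝ) (b : EReal) (H : ℝ → Matrix (Fin 2) (Fin 2) ℝ) : Prop where
  a_lt_b : (a : EReal) < b
  posSemidef : ∀ᵐ (t : ℝ) ∂volume, a ≤ t → (t : EReal) < b → (H t).PosSemidef
  locInt : ∀ (i j : Fin 2) (t : ℝ), a ≤ t → (t : EReal) < b →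
    IntervalIntegrable (fun s => H s i j) volume a t
  zero_null : volume {t : ℝ | a ≤ t ∧ (t : EReal) < b ∧ H t = 0} = 0
  limit_point : (∫⁻ t in {t : ℝ | a ≤ t ∧ (t : EReal) < b},
    ENNReal.ofReal ((H t).trace)) = ⊤

/-- `m1(t) = ∫_a^t h1`. -/
def m1 (a : ℝ) (H : ℝ → Matrix (Fin 2) (Fin 2) ℝ) (t : ℝ) : ℝ := ∫ s in a..t, H s 0 0

/-- `m2(t) = ∫_a^t h2`. -/
def m2 (a : ℝ) (H : ℝ → Matrix (Fin 2) (Fin 2) ℝ) (t : ℝ) : ℝ := ∫ s in a..t, H s 1 1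

/-- `m3(t) = ∫_a^t h3`. -/
def m3 (a : ℝ) (H : ℝ → Matrix (Fin 2) (Fin 2) ℝ) (t : ℝ) : ℝ := ∫ s in a..t, H s 0 1

/-- `M(t) = ∫_a^t H(s) ds`. -/
def Mmat (a : ℝ) (H : ℝ → Matrix (Fin 2) (Fin 2) ℝ) (t : ℝ) : Matrix (Fin 2) (Fin 2) ℝ :=
  !![m1 a H t, m3 a H t; m3 a H t, m2 a H t]

/-- Neither diagonal entry of `H` vanishes a.e. on any neighbourhood of `a`. -/
def DiagNonVanishing (a : ℝ) (b : EReal) (H : ℝ → Matrix (Fin 2) (Fin 2) ℝ) : Prop :=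
  (∀ t : ℝ, a < t → (t : EReal) < b →
    ¬ ∀ᵐ s ∂(volume.restrict (Set.Ioo a t)), H s 0 0 = 0) ∧
  (∀ t : ℝ, a < t → (t : EReal) < b →
    ¬ ∀ᵐ s ∂(volume.restrict (Set.Ioo a t)), H s 1 1 = 0)

/-- `W` is the fundamental solution of `W(t,z)J − J = z ∫_a^t W(s,z)H(s) ds`. -/
def IsFundamentalSolution (a : ℝ) (b : EReal) (H : ℝ → Matrix (Fin 2) (Fin 2) ℝ)
    (W : ℝ → ℂ → Matrix (Fin 2) (Fin 2) ℂ) : Prop :=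
  ∀ (z : ℂ) (t : ℝ), a ≤ t → (t : EReal) < b →
    W t z * JmatC - JmatC =
      z • Matrix.of fun i j =>
        ∫ s in a..t, (W s z * (H s).map (fun x : ℝ => (x : ℂ))) i j

/-- `qH` is the Weyl coefficient of the Hamiltonian `H`. -/
def IsWeylCoefficient (a : ℝ) (b : EReal) (H : ℝ → Matrix (Fin 2) (Fin 2) ℝ)
    (qH : ℂ → ℂ) : Prop :=
  ∃ W : ℝ → ℂ → Matrix (Fin 2) (Fin 2) ℂ,
    IsFundamentalSolution a b H W ∧
    ∀ z : ℂ, z.im ≠ 0 → ∀ ζ : ℂ, 0 ≤ ζ.im →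
      Tendsto (fun t : ℝ =>
          (W t z 0 0 * ζ + W t z 0 1) / (W t z 1 0 * ζ + W t z 1 1))
        (toBFilter b) (nhds (qH z))

/-- `μ` is the spectral measure of `H`, i.e. the measure in the Herglotz
representation of the Weyl coefficient of `H`. -/
def IsSpectralMeasure (a : ℝ) (b : EReal) (H : ℝ → Matrix (Fin 2) (Fin 2) ℝ)
    (μ : Measure ℝ) : Prop :=
  ∃ qH : ℂ → ℂ, IsWeylCoefficient a b H qH ∧
    (∫⁻ t : ℝ, ENNReal.ofReal (1 / (1 + t ^ 2)) ∂μ) < ⊤ ∧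
    ∃ α β : ℝ, 0 ≤ β ∧ ∀ z : ℂ, z.im ≠ 0 →
      qH z = (α : ℂ) + (β : ℂ) * z +
        ∫ t : ℝ, (1 / ((t : ℂ) - z) - (t : ℂ) / (1 + (t : ℂ) ^ 2)) ∂μ

/-- `μ↔(r) = μ((−r, r))`. -/
def muSym (μ : Measure ℝ) (r : ℝ) : ℝ≥0∞ := μ (Set.Ioo (-r) r)

/-- Poisson integral of a measure. -/
def poisson (μ : Measure ℝ) (z : ℂ) : ℝ := ∫ t : ℝ, (1 / ((t : ℂ) - z)).im ∂μ

/-- `g : (0,∞) → (0,∞)` is regularly varying with index `ρ`. -/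
def RegularlyVarying (g : ℝ → ℝ) (ρ : ℝ) : Prop :=
  Measurable g ∧ (∀ r : ℝ, 0 < r → 0 < g r) ∧
  ∀ l : ℝ, 0 < l → Tendsto (fun r : ℝ => g (l * r) / g r) atTop (nhds (l ^ ρ))

/-- `g⋆(r) = ∫_1^r t/g(t) dt`. -/
def gstar (g : ℝ → ℝ) (r : ℝ) : ℝ := ∫ t in (1:ℝ)..r, t / g t

/-- The Kac class `𝓜_g`. -/
def memMg (g : ℝ → ℝ) (μ : Measure ℝ) : Prop :=
  (∫⁻ r in Set.Ici (1:ℝ), ENNReal.ofReal (1 / g r)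
    ∂(Measure.map (fun t : ℝ => |t|) μ)) < ⊤

/-- The class `𝓜̂_g`. -/
def memMhat (g : ℝ → ℝ) (μ : Measure ℝ) : Prop :=
  (∫⁻ r in Set.Ioi (1:ℝ), muSym μ r * ENNReal.ofReal (gstar g r / r ^ 3)) < ⊤

/-- The class `𝓕_g`: `μ↔(r) = O(g(r))`. -/
def memFg (g : ℝ → ℝ) (μ : Measure ℝ) : Prop :=
  ∃ C : ℝ, ∀ᶠ r in atTop, muSym μ r ≤ ENNReal.ofReal (C * g r)

/-- The class `𝓕_g⁰`: `μ↔(r) = o(g(r))`. -/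
def memFg0 (g : ℝ → ℝ) (μ : Measure ℝ) : Prop :=
  ∀ ε : ℝ, 0 < ε → ∀ᶠ r in atTop, muSym μ r ≤ ENNReal.ofReal (ε * g r)

/-- `M⁺(t)`. -/
def MplusMat (a : ℝ) (H : ℝ → Matrix (Fin 2) (Fin 2) ℝ) (t : ℝ) :
    Matrix (Fin 2) (Fin 2) ℝ :=
  !![m1 a H t, Real.sqrt (m1 a H t * m2 a H t);
     Real.sqrt (m1 a H t * m2 a H t), m2 a H t]

/-- `m⁺(t) = 2√(m1(t)m2(t))`. -/
def mplus (a : ℝ) (H : ℝ → Matrix (Fin 2) (Fin 2) ℝ) (t : ℝ) : ℝ :=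
  2 * Real.sqrt (m1 a H t * m2 a H t)

/-- `W` is the sequence of power series coefficients of the fundamental solution:
`W_0 = I`, `W_{n+1}(t) = (∫_a^t W_n H)·(−J)`. -/
def IsCoeffSeq (a : ℝ) (H : ℝ → Matrix (Fin 2) (Fin 2) ℝ)
    (W : ℕ → ℝ → Matrix (Fin 2) (Fin 2) ℝ) : Prop :=
  (∀ t : ℝ, W 0 t = 1) ∧
  ∀ (n : ℕ) (t : ℝ),
    W (n + 1) t = (Matrix.of fun i j => ∫ s in a..t, (W n s * H s) i j) * (-Jmat)

/-- Entrywise integral of a matrix-valued function. -/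
def intMat (f : ℝ → Matrix (Fin 2) (Fin 2) ℝ) (a t : ℝ) : Matrix (Fin 2) (Fin 2) ℝ :=
  Matrix.of fun i j => ∫ s in a..t, f s i j

/-- `α_{n,m}(t) = ∫_a^t W_n H W_m* ds`. -/
def alphaMat (a : ℝ) (H : ℝ → Matrix (Fin 2) (Fin 2) ℝ)
    (W : ℕ → ℝ → Matrix (Fin 2) (Fin 2) ℝ) (n m : ℕ) (t : ℝ) :
    Matrix (Fin 2) (Fin 2) ℝ :=
  intMat (fun s => W n s * H s * (W m s)ᵀ) a t

/-- `β_{n,m}(t) = W_n(t) J W_m(t)*`. -/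
def betaMat (W : ℕ → ℝ → Matrix (Fin 2) (Fin 2) ℝ) (n m : ℕ) (t : ℝ) :
    Matrix (Fin 2) (Fin 2) ℝ :=
  W n t * Jmat * (W m t)ᵀ

/-- `∇(t,z) = ∫_a^t W(s,z) H(s) W(s,z)* ds`. -/
def nablaMat (a : ℝ) (H : ℝ → Matrix (Fin 2) (Fin 2) ℝ)
    (W : ℝ → ℂ → Matrix (Fin 2) (Fin 2) ℂ) (t : ℝ) (z : ℂ) :
    Matrix (Fin 2) (Fin 2) ℂ :=
  Matrix.of fun i j =>
    ∫ s in a..t, (W s z * (H s).map (fun x : ℝ => (x : ℂ)) * (W s z)ᴴ) i j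

/-- Generalised inverse of `f : [a,b) → ℝ`. -/
def genInv (a : ℝ) (b : EReal) (f : ℝ → ℝ) (y : ℝ) : ℝ :=
  sInf {x : ℝ | a ≤ x ∧ (x : EReal) < b ∧ y ≤ f x}

/-- Generalised inverse of `f : [0,b) → [0,∞]`. -/
def genInvE (b : EReal) (f : ℝ → ℝ≥0∞) (y : ℝ) : ℝ :=
  sInf {x : ℝ | 0 ≤ x ∧ (x : EReal) < b ∧ ENNReal.ofReal y ≤ f x}


section AbsolutelyContinuousAux

theorem AbsolutelyContinuousOnInterval.lipschitzOnWith_comp {X Y : Type*} [PseudoMetricSpace X]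
    [PseudoMetricSpace Y] {f : ℝ → X} {φ : X → Y} {s : Set X} {K : NNReal} {a b : ℝ}
    (hf : AbsolutelyContinuousOnInterval f a b) (hφ : LipschitzOnWith K φ s)
    (hs : MapsTo f (uIcc a b) s) : AbsolutelyContinuousOnInterval (fun x => φ (f x)) a b := by
  rw [absolutelyContinuousOnInterval_iff] at hf ⊢
  intro ε hε
  obtain ⟨δ, hδ, h⟩ := hf (ε / (K + 1)) (by positivity)
  refine ⟨δ, hδ, fun E hE hlt => ?_⟩
  have h1 := h E hE hlt
  have h2 : ∑ i ∈ Finset.range E.1, dist (φ (f (E.2 i).1)) (φ (f (E.2 i).2)) ≤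
      (K + 1) * ∑ i ∈ Finset.range E.1, dist (f (E.2 i).1) (f (E.2 i).2) := by
    rw [Finset.mul_sum]
    refine Finset.sum_le_sum fun i hi => ?_
    refine (hφ.dist_le_mul _ (hs (hE.1 i hi).1) _ (hs (hE.1 i hi).2)).trans ?_
    gcongr
    linarith
  have hK : (0 : ℝ) < K + 1 := by positivity
  calc _ ≤ _ := h2
    _ < (K + 1) * (ε / (K + 1)) := by gcongr
    _ = ε := by field_simp

theorem IntervalIntegrable.absolutelyContinuousOnInterval_integral_complex {f : ℝ → ℂ}
    {a b c : ℝ} (h : IntervalIntegrable f volume a b) (hc : c ∈ uIcc a b) :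
    AbsolutelyContinuousOnInterval (fun x => ∫ v in c..x, f v) a b := by
  have hre : IntervalIntegrable (fun x => (f x).re) volume a b := ⟨h.1.re, h.2.re⟩
  have him : IntervalIntegrable (fun x => (f x).im) volume a b := ⟨h.1.im, h.2.im⟩
  have h1 := (hre.absolutelyContinuousOnInterval_intervalIntegral hc).lipschitzOnWith_comp
    (Complex.isometry_ofReal.lipschitz.lipschitzOnWith (s := univ)) (fun _ _ => mem_univ _)
  have h2 := (him.absolutelyContinuousOnInterval_intervalIntegral hc).lipschitzOnWith_comp
    (Complex.isometry_ofReal.lipschitz.lipschitzOnWith (s := univ)) (fun _ _ => mem_univ _)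
  have h3 := h1.add (h2.const_smul Complex.I)
  rw [absolutelyContinuousOnInterval_iff] at h3 ⊢
  intro ε hε
  obtain ⟨δ, hδ, h4⟩ := h3 ε hε
  refine ⟨δ, hδ, fun E hE hlt => ?_⟩
  have h5 := h4 E hE hlt
  have key : ∀ x ∈ uIcc a b, (∫ v in c..x, f v) =
      ((∫ v in c..x, (f v).re : ℝ) : ℂ) + Complex.I • ((∫ v in c..x, (f v).im : ℝ) : ℂ) := by
    intro x hx
    have hcx : IntervalIntegrable f volume c x := h.mono_set (uIcc_subset_uIcc hc hx)
    apply Complex.ext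
    · have := intervalIntegral.intervalIntegral_re hcx
      simpa using this.symm
    · have := intervalIntegral.intervalIntegral_im hcx
      simpa using this.symm
  refine lt_of_le_of_lt (le_of_eq ?_) h5
  refine Finset.sum_congr rfl fun i hi => ?_
  rw [key _ (hE.1 i hi).1, key _ (hE.1 i hi).2]
  rfl

theorem AbsolutelyContinuousOnInterval.integral_eq_sub_of_ae_hasDerivAt {E : Type*}
    [NormedAddCommGroup E] [NormedSpace ℝ E] [CompleteSpace E] {F g : ℝ → E} {a b : ℝ}
    (hF : AbsolutelyContinuousOnInterval F a b)
    (hg : IntervalIntegrable g volume a b)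
    (hG : AbsolutelyContinuousOnInterval (fun x => ∫ v in a..x, g v) a b)
    (hd : ∀ᵐ x, x ∈ uIcc a b → HasDerivAt F (g x) x) :
    ∫ x in a..b, g x = F b - F a := by
  have hsub := hF.sub hG
  have h0 : ∀ᵐ x, x ∈ uIcc a b → HasDerivAt (F - fun x => ∫ v in a..x, g v) 0 x := by
    filter_upwards [hd, hg.ae_hasDerivAt_integral] with x h1 h2 hx
    simpa using (h1 hx).sub (h2 hx a left_mem_uIcc)
  obtain ⟨C, hC⟩ := hsub.const_of_ae_hasDerivAt_zero h0
  have ha := hC a left_mem_uIcc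
  have hb := hC b right_mem_uIcc
  simp only [Pi.sub_apply, intervalIntegral.integral_same, sub_zero] at ha hb
  rw [ha, ← hb]
  abel

end AbsolutelyContinuousAux

section VolterraSystem

/-- The `i`-th component of the row vector `u(s) k(s)`. -/
def rowMul (u : ℝ → Fin 2 → ℂ) (k : Fin 2 → Fin 2 → ℝ → ℂ) (i : Fin 2) (s : ℝ) : ℂ :=
  u s 0 * k 0 i s + u s 1 * k 1 i s

variable {u : ℝ → Fin 2 → ℂ} {k : Fin 2 → Fin 2 → ℝ → ℂ} {a T : ℝ} {c : Fin 2 → ℂ}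

theorem integrableOn_rowMul {s : Set ℝ} (hs : MeasurableSet s)
    (hk : ∀ i j, IntegrableOn (k i j) s)
    (hu : ∀ i, AEStronglyMeasurable (fun t => u t i) (volume.restrict s))
    {C : ℝ} (hC : ∀ t ∈ s, ∀ i, ‖u t i‖ ≤ C) (i : Fin 2) : IntegrableOn (rowMul u k i) s := by
  have h : ∀ j, IntegrableOn (fun t => u t j * k j i t) s := fun j =>
    (hk j i).bdd_mul (hu j) ((ae_restrict_iff' hs).2 (Eventually.of_forall fun t ht => hC t ht j))
  exact (h 0).add (h 1)

theorem continuousOn_of_volterra {t : ℝ} (hat : a ≤ t) (htT : t ≤ T)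
    (hu : ∀ t ∈ Icc a T, ∀ i, u t i = c i + ∫ s in a..t, rowMul u k i s) {i : Fin 2}
    (hi : IntervalIntegrable (rowMul u k i) volume a t) :
    ContinuousOn (fun s => u s i) (Icc a t) := by
  have h := intervalIntegral.continuousOn_primitive_interval' hi left_mem_uIcc
  rw [uIcc_of_le hat] at h
  exact (continuousOn_const.add h).congr fun s hs => hu s ⟨hs.1, hs.2.trans htT⟩ i

theorem integrable_extend_of_volterra (hk : ∀ i j, IntervalIntegrable (k i j) volume a T)
    (hu : ∀ t ∈ Icc a T, ∀ i, u t i = c i + ∫ s in a..t, rowMul u k i s)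
    {t₀ : ℝ} (hat : a ≤ t₀) (htT : t₀ < T)
    (h0 : ∀ i, IntervalIntegrable (rowMul u k i) volume a t₀) :
    ∃ t₁, t₀ < t₁ ∧ t₁ ≤ T ∧ ∀ i, IntervalIntegrable (rowMul u k i) volume a t₁ := by
  have hmono : ∀ i {s t : ℝ}, a ≤ s → s ≤ t → IntervalIntegrable (rowMul u k i) volume a t →
      IntervalIntegrable (rowMul u k i) volume a s := fun i s t h1 h2 h =>
    h.mono_set (by rw [uIcc_of_le h1, uIcc_of_le (h1.trans h2)]; exact Icc_subset_Icc_right h2)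
  have hdich : ∀ i, ∃ t₁, t₀ < t₁ ∧ t₁ ≤ T ∧ (IntervalIntegrable (rowMul u k i) volume a t₁ ∨
      ∀ t, t₀ < t → t ≤ t₁ → ¬ IntervalIntegrable (rowMul u k i) volume a t) := by
    intro i
    by_cases h : ∃ t₁, t₀ < t₁ ∧ t₁ ≤ T ∧ IntervalIntegrable (rowMul u k i) volume a t₁
    · obtain ⟨t₁, h1, h2, h3⟩ := h
      exact ⟨t₁, h1, h2, Or.inl h3⟩
    · push Not at h
      exact ⟨T, htT, le_rfl, Or.inr h⟩
  choose τ hτ0 hτT hτ using hdich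
  have hm : ∃ t₁, t₀ < t₁ ∧ t₁ ≤ T ∧ ∀ i, t₁ ≤ τ i := by
    refine ⟨min (τ 0) (τ 1), lt_min (hτ0 0) (hτ0 1), (min_le_left _ _).trans (hτT 0), ?_⟩
    intro i
    fin_cases i
    · exact min_le_left _ _
    · exact min_le_right _ _
  obtain ⟨t₁, h01, h1T, h1τ⟩ := hm
  refine ⟨t₁, h01, h1T, ?_⟩
  have ha1 : a ≤ t₁ := hat.trans h01.le
  have hunion : Icc a t₀ ∪ Ioc t₀ t₁ = Icc a t₁ := Icc_union_Ioc_eq_Icc hat h01.le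
  have hbd : ∀ i, AEStronglyMeasurable (fun t => u t i) (volume.restrict (Icc a t₁)) ∧
      ∃ C : ℝ, ∀ t ∈ Icc a t₁, ‖u t i‖ ≤ C := by
    intro i
    rcases hτ i with h | h
    · have hc := continuousOn_of_volterra ha1 h1T hu (hmono i ha1 (h1τ i) h)
      exact ⟨hc.aestronglyMeasurable measurableSet_Icc,
        isCompact_Icc.exists_bound_of_continuousOn hc⟩
    · have hc := continuousOn_of_volterra hat htT.le hu (h0 i)
      have hconst : ∀ t ∈ Ioc t₀ t₁, u t i = c i := by
        intro t ht
        rw [hu t ⟨hat.trans ht.1.le, ht.2.trans h1T⟩ i,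
          intervalIntegral.integral_undef (h t ht.1 (ht.2.trans (h1τ i))), add_zero]
      obtain ⟨C, hC⟩ := isCompact_Icc.exists_bound_of_continuousOn hc
      refine ⟨?_, max C ‖c i‖, ?_⟩
      · rw [← hunion, aestronglyMeasurable_union_iff]
        refine ⟨hc.aestronglyMeasurable measurableSet_Icc, ?_⟩
        exact (continuousOn_const.congr hconst).aestronglyMeasurable measurableSet_Ioc
      · intro t ht
        rw [← hunion] at ht
        rcases ht with ht | ht
        · exact (hC t ht).trans (le_max_left _ _)
        · rw [hconst t ht]
          exact le_max_right _ _
  obtain ⟨C0, hC0⟩ := (hbd 0).2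
  obtain ⟨C1, hC1⟩ := (hbd 1).2
  intro i
  rw [intervalIntegrable_iff_integrableOn_Icc_of_le ha1]
  refine integrableOn_rowMul measurableSet_Icc (fun i j => ?_) (fun i => (hbd i).1)
    (C := max C0 C1) ?_ i
  · have := (hk i j).mono_set (c := a) (d := t₁) (by
      rw [uIcc_of_le ha1, uIcc_of_le (ha1.trans h1T)]; exact Icc_subset_Icc_right h1T)
    rwa [intervalIntegrable_iff_integrableOn_Icc_of_le ha1] at this
  · intro t ht j
    fin_cases j
    · exact (hC0 t ht).trans (le_max_left _ _)
    · exact (hC1 t ht).trans (le_max_right _ _)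

theorem integrable_limit_of_volterra (hk : ∀ i j, IntervalIntegrable (k i j) volume a T)
    (hu : ∀ t ∈ Icc a T, ∀ i, u t i = c i + ∫ s in a..t, rowMul u k i s)
    {t₀ : ℝ} (hat : a < t₀) (htT : t₀ ≤ T)
    (h0 : ∀ t ∈ Ico a t₀, ∀ i, IntervalIntegrable (rowMul u k i) volume a t) (i : Fin 2) :
    IntervalIntegrable (rowMul u k i) volume a t₀ := by
  have hcont : ∀ t ∈ Ico a t₀, ∀ i, ContinuousOn (fun s => u s i) (Icc a t) := fun t ht i =>
    continuousOn_of_volterra ht.1 (ht.2.le.trans htT) hu (h0 t ht i)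
  have hk0 : ∀ i j, IntervalIntegrable (k i j) volume a t₀ := fun i j =>
    (hk i j).mono_set (by
      rw [uIcc_of_le hat.le, uIcc_of_le (hat.le.trans htT)]; exact Icc_subset_Icc_right htT)
  set κ : ℝ → ℝ := fun s => ‖k 0 0 s‖ + ‖k 0 1 s‖ + ‖k 1 0 s‖ + ‖k 1 1 s‖ with hκ
  have hκi : IntervalIntegrable κ volume a t₀ :=
    (((hk0 0 0).norm.add (hk0 0 1).norm).add (hk0 1 0).norm).add (hk0 1 1).norm
  have hκ0 : ∀ s, 0 ≤ κ s := fun s => by positivity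
  -- a point `s₀` after which the kernel has small mass
  obtain ⟨s₀, hs₀, hsmall⟩ : ∃ s₀ ∈ Ico a t₀, ∫ s in s₀..t₀, κ s ≤ 1 / 2 := by
    have hc := intervalIntegral.continuousOn_primitive_interval' hκi.symm left_mem_uIcc
    rw [uIcc_comm, uIcc_of_le hat.le] at hc
    have h1 := (hc t₀ (right_mem_Icc.2 hat.le)).mono_left
      (nhdsWithin_mono _ (Ico_subset_Icc_self : Ico a t₀ ⊆ Icc a t₀))
    simp only [intervalIntegral.integral_same] at h1
    have h2 : Tendsto (fun s => ∫ x in t₀..s, κ x) (𝓝[Ico a t₀] t₀) (𝓝 0) := h1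
    have h3 : ∀ᶠ s in 𝓝[Ico a t₀] t₀, (-(1 / 2 : ℝ)) < ∫ x in t₀..s, κ x :=
      h2.eventually (lt_mem_nhds (by norm_num))
    have : (𝓝[Ico a t₀] t₀).NeBot := by
      rw [← mem_closure_iff_nhdsWithin_neBot, closure_Ico hat.ne]
      exact right_mem_Icc.2 hat.le
    obtain ⟨s, hs1, hs2⟩ := (h3.and self_mem_nhdsWithin).exists
    refine ⟨s, hs2, ?_⟩
    rw [intervalIntegral.integral_symm]
    linarith
  have hbd : ∀ t ∈ Ico s₀ t₀, ∀ i, ‖u t i‖ ≤ 2 * ‖u s₀‖ := by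
    intro t ht
    have ht' : t ∈ Ico a t₀ := ⟨hs₀.1.trans ht.1, ht.2⟩
    have hcu : ContinuousOn u (Icc s₀ t) := continuousOn_pi.2 fun i =>
      (hcont t ht' i).mono (Icc_subset_Icc_left hs₀.1)
    obtain ⟨x, hx, hmax⟩ := isCompact_Icc.exists_isMaxOn (nonempty_Icc.2 ht.1) hcu.norm
    have hN : ∀ s ∈ Icc s₀ t, ‖u s‖ ≤ ‖u x‖ := fun s hs => hmax hs
    have hx' : x ∈ Ico a t₀ := ⟨hs₀.1.trans hx.1, hx.2.trans_lt ht.2⟩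
    have key : ∀ i, ‖u x i‖ ≤ ‖u s₀‖ + ‖u x‖ * (1 / 2) := by
      intro i
      have e1 : u x i = u s₀ i + ∫ s in s₀..x, rowMul u k i s := by
        rw [hu x ⟨hx'.1, hx'.2.le.trans htT⟩ i, hu s₀ ⟨hs₀.1, hs₀.2.le.trans htT⟩ i,
          ← intervalIntegral.integral_interval_sub_left (h0 x hx' i) (h0 s₀ hs₀ i)]
        ring
      have hκs : IntervalIntegrable κ volume s₀ t₀ := hκi.mono_set (by
        rw [uIcc_of_le hs₀.2.le, uIcc_of_le hat.le]; exact Icc_subset_Icc_left hs₀.1)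
      have hκx : IntervalIntegrable κ volume s₀ x := hκs.mono_set (by
        rw [uIcc_of_le hx.1, uIcc_of_le hs₀.2.le]; exact Icc_subset_Icc_right hx'.2.le)
      have e2 : ‖∫ s in s₀..x, rowMul u k i s‖ ≤ ∫ s in s₀..x, ‖u x‖ * κ s := by
        refine intervalIntegral.norm_integral_le_of_norm_le hx.1
          (Eventually.of_forall fun s hs => ?_) (hκx.const_mul _)
        have hu0 := hN s ⟨hs.1.le, hs.2.trans hx.2⟩
        have hj : ∀ j, ‖u s j‖ ≤ ‖u x‖ := fun j => (norm_le_pi_norm (u s) j).trans hu0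
        have hsum : ‖k 0 i s‖ + ‖k 1 i s‖ ≤ κ s := by
          have := norm_nonneg (k 0 0 s)
          have := norm_nonneg (k 0 1 s)
          have := norm_nonneg (k 1 0 s)
          have := norm_nonneg (k 1 1 s)
          fin_cases i <;> simp only [hκ, Fin.zero_eta, Fin.mk_one] <;> linarith
        calc ‖rowMul u k i s‖ ≤ ‖u s 0 * k 0 i s‖ + ‖u s 1 * k 1 i s‖ := norm_add_le _ _
          _ = ‖u s 0‖ * ‖k 0 i s‖ + ‖u s 1‖ * ‖k 1 i s‖ := by rw [norm_mul, norm_mul]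
          _ ≤ ‖u x‖ * ‖k 0 i s‖ + ‖u x‖ * ‖k 1 i s‖ := by gcongr <;> exact hj _
          _ = ‖u x‖ * (‖k 0 i s‖ + ‖k 1 i s‖) := by ring
          _ ≤ ‖u x‖ * κ s := by gcongr
      have e3 : ∫ s in s₀..x, κ s ≤ 1 / 2 := by
        refine le_trans ?_ hsmall
        exact intervalIntegral.integral_mono_interval le_rfl hx.1 hx'.2.le
          (Eventually.of_forall hκ0) hκs
      rw [intervalIntegral.integral_const_mul] at e2
      rw [e1]
      calc _ ≤ ‖u s₀ i‖ + ‖∫ s in s₀..x, rowMul u k i s‖ := norm_add_le _ _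
        _ ≤ ‖u s₀‖ + ‖u x‖ * (1 / 2) := by
          gcongr
          · exact norm_le_pi_norm _ _
          · exact e2.trans (by gcongr)
    have hux : ‖u x‖ ≤ ‖u s₀‖ + ‖u x‖ * (1 / 2) := by
      rw [pi_norm_le_iff_of_nonneg (by positivity)]
      exact key
    intro i
    have := (norm_le_pi_norm (u t) i).trans (hN t (right_mem_Icc.2 ht.1))
    linarith
  have hmeas : ∀ i, AEStronglyMeasurable (fun t => u t i) (volume.restrict (Ico a t₀)) := by
    intro i
    refine ContinuousOn.aestronglyMeasurable (fun t ht => ?_) measurableSet_Ico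
    obtain ⟨t', h1, h2⟩ := exists_between ht.2
    have h3 := hcont t' ⟨ht.1.trans h1.le, h2⟩ i t ⟨ht.1, h1.le⟩
    refine h3.mono_of_mem_nhdsWithin ?_
    filter_upwards [self_mem_nhdsWithin, mem_nhdsWithin_of_mem_nhds (gt_mem_nhds h1)]
      with y hy1 hy2
    exact ⟨hy1.1, le_of_lt hy2⟩
  have hb0 : ∃ C, ∀ t ∈ Icc a s₀, ‖u t‖ ≤ C :=
    isCompact_Icc.exists_bound_of_continuousOn (continuousOn_pi.2 (hcont s₀ hs₀))
  obtain ⟨C, hC⟩ := hb0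
  rw [intervalIntegrable_iff_integrableOn_Ico_of_le hat.le]
  refine integrableOn_rowMul measurableSet_Ico (fun i j => ?_) hmeas
    (C := max C (2 * ‖u s₀‖)) (fun t ht j => ?_) i
  · have := hk0 i j
    rwa [intervalIntegrable_iff_integrableOn_Ico_of_le hat.le] at this
  · rcases le_total t s₀ with h | h
    · exact (norm_le_pi_norm _ _).trans ((hC t ⟨ht.1, h⟩).trans (le_max_left _ _))
    · exact (hbd t ⟨h, ht.2⟩ j).trans (le_max_right _ _)

/-- A solution of a linear Volterra system with integrable kernel is automatically regular enough
for the integrals in the system to exist. -/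
theorem intervalIntegrable_of_volterra (haT : a ≤ T)
    (hk : ∀ i j, IntervalIntegrable (k i j) volume a T)
    (hu : ∀ t ∈ Icc a T, ∀ i, u t i = c i + ∫ s in a..t, rowMul u k i s) (i : Fin 2) :
    IntervalIntegrable (rowMul u k i) volume a T := by
  set G : Set ℝ := {t | t ∈ Icc a T ∧ ∀ i, IntervalIntegrable (rowMul u k i) volume a t} with hG
  have haG : a ∈ G := ⟨left_mem_Icc.2 haT, fun i => IntervalIntegrable.refl⟩
  have hbdd : BddAbove G := ⟨T, fun t ht => ht.1.2⟩
  have h1 : a ≤ sSup G := le_csSup hbdd haG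
  have h2 : sSup G ≤ T := csSup_le ⟨a, haG⟩ fun t ht => ht.1.2
  have hsup : ∀ i, IntervalIntegrable (rowMul u k i) volume a (sSup G) := by
    rcases h1.eq_or_lt with h | h
    · rw [← h]
      exact haG.2
    · refine integrable_limit_of_volterra hk hu h h2 fun t ht i => ?_
      obtain ⟨t', ht', htt⟩ := exists_lt_of_lt_csSup ⟨a, haG⟩ ht.2
      exact (ht'.2 i).mono_set (by
        rw [uIcc_of_le ht.1, uIcc_of_le ht'.1.1]; exact Icc_subset_Icc_right htt.le)
  rcases h2.eq_or_lt with h | h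
  · rw [← h]
    exact hsup i
  · obtain ⟨t₁, h3, h4, h5⟩ := integrable_extend_of_volterra hk hu h1 h hsup
    exact absurd (le_csSup hbdd (⟨⟨h1.trans h3.le, h4⟩, h5⟩ : t₁ ∈ G)) (not_le.2 h3)

end VolterraSystem

section RowSolutions

/-- The coefficient kernel of the canonical system, acting on row vectors. -/
def hamKernel (H : ℝ → Matrix (Fin 2) (Fin 2) ℝ) (z : ℂ) (i j : Fin 2) (s : ℝ) : ℂ :=
  if j = 0 then -(z * H s i 1) else z * H s i 0

/-- `u` is a row vector solution of the canonical system on `[a, T]`. -/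
def IsRowSolution (H : ℝ → Matrix (Fin 2) (Fin 2) ℝ) (z : ℂ) (a T : ℝ)
    (u : ℝ → Fin 2 → ℂ) : Prop :=
  ∀ t ∈ Icc a T, ∀ i, u t i = u a i + ∫ s in a..t, rowMul u (hamKernel H z) i s

variable {H : ℝ → Matrix (Fin 2) (Fin 2) ℝ} {z w : ℂ} {a T : ℝ} {u v : ℝ → Fin 2 → ℂ}

theorem intervalIntegrable_hamKernel (hH : ∀ i j, IntervalIntegrable (fun s => H s i j) volume a T)
    (z : ℂ) (i j : Fin 2) : IntervalIntegrable (hamKernel H z i j) volume a T := by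
  have h : ∀ i j, IntervalIntegrable (fun s => z * (H s i j : ℂ)) volume a T := fun i j =>
    IntervalIntegrable.const_mul ⟨(hH i j).1.ofReal, (hH i j).2.ofReal⟩ z
  unfold hamKernel
  split_ifs
  · exact (h i 1).neg
  · exact h i 0

theorem IsRowSolution.mono (hu : IsRowSolution H z a T u) {t : ℝ} (ht : t ≤ T) :
    IsRowSolution H z a t u := fun s hs => hu s ⟨hs.1, hs.2.trans ht⟩

theorem IsRowSolution.intervalIntegrable (hu : IsRowSolution H z a T u) (haT : a ≤ T)
    (hH : ∀ i j, IntervalIntegrable (fun s => H s i j) volume a T) (i : Fin 2) :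
    IntervalIntegrable (rowMul u (hamKernel H z) i) volume a T :=
  intervalIntegrable_of_volterra haT (intervalIntegrable_hamKernel hH z) hu i

theorem IsRowSolution.continuousOn (hu : IsRowSolution H z a T u) (haT : a ≤ T)
    (hH : ∀ i j, IntervalIntegrable (fun s => H s i j) volume a T) (i : Fin 2) :
    ContinuousOn (fun t => u t i) (Icc a T) :=
  continuousOn_of_volterra haT le_rfl hu (hu.intervalIntegrable haT hH i)

theorem IsRowSolution.sub_smul (hu : IsRowSolution H z a T u) (hv : IsRowSolution H z a T v)
    (haT : a ≤ T) (hH : ∀ i j, IntervalIntegrable (fun s => H s i j) volume a T) (c : ℂ) :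
    IsRowSolution H z a T fun t => u t - c • v t := by
  intro t ht i
  have h1 := (hu.intervalIntegrable haT hH i).mono_set
    (c := a) (d := t) (by rw [uIcc_of_le ht.1, uIcc_of_le haT]; exact Icc_subset_Icc_right ht.2)
  have h2 := (hv.intervalIntegrable haT hH i).mono_set
    (c := a) (d := t) (by rw [uIcc_of_le ht.1, uIcc_of_le haT]; exact Icc_subset_Icc_right ht.2)
  have h3 : ∀ s, rowMul (fun t => u t - c • v t) (hamKernel H z) i s =
      rowMul u (hamKernel H z) i s - c * rowMul v (hamKernel H z) i s := by
    intro s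
    simp only [rowMul, Pi.sub_apply, Pi.smul_apply, smul_eq_mul]
    ring
  simp only [h3, Pi.sub_apply, Pi.smul_apply, smul_eq_mul]
  rw [intervalIntegral.integral_sub h1 (h2.const_mul c), intervalIntegral.integral_const_mul,
    hu t ht i, hv t ht i]
  ring

theorem IsRowSolution.conj (hu : IsRowSolution H z a T u) :
    IsRowSolution H (starRingEnd ℂ z) a T fun t i => starRingEnd ℂ (u t i) := by
  intro t ht i
  have h : ∀ s, rowMul (fun t i => starRingEnd ℂ (u t i)) (hamKernel H (starRingEnd ℂ z)) i s =
      starRingEnd ℂ (rowMul u (hamKernel H z) i s) := by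
    intro s
    simp only [rowMul, hamKernel]
    split_ifs <;> simp
  simp only [h]
  rw [intervalIntegral.intervalIntegral_conj, ← map_add, ← hu t ht i]

/-- Lagrange's identity for the canonical system. -/
theorem IsRowSolution.lagrange (hu : IsRowSolution H z a T u) (hv : IsRowSolution H w a T v)
    (haT : a ≤ T) (hH : ∀ i j, IntervalIntegrable (fun s => H s i j) volume a T)
    (hsymm : ∀ᵐ s, s ∈ Icc a T → H s 1 0 = H s 0 1) :
    ∫ s in a..T, (z - w) * (u s 0 * H s 0 0 * v s 0 + u s 0 * H s 0 1 * v s 1 +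
        u s 1 * H s 0 1 * v s 0 + u s 1 * H s 1 1 * v s 1) =
      (u T 1 * v T 0 - u T 0 * v T 1) - (u a 1 * v a 0 - u a 0 * v a 1) := by
  have hui := hu.intervalIntegrable haT hH
  have hvi := hv.intervalIntegrable haT hH
  have hmem : a ∈ uIcc a T := left_mem_uIcc
  set U : Fin 2 → ℝ → ℂ := fun i t => u a i + ∫ s in a..t, rowMul u (hamKernel H z) i s with hU
  set V : Fin 2 → ℝ → ℂ := fun i t => v a i + ∫ s in a..t, rowMul v (hamKernel H w) i s with hV
  have hUu : ∀ i, ∀ t ∈ Icc a T, U i t = u t i := fun i t ht => (hu t ht i).symm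
  have hVv : ∀ i, ∀ t ∈ Icc a T, V i t = v t i := fun i t ht => (hv t ht i).symm
  have hcst : ∀ c : ℂ, AbsolutelyContinuousOnInterval (fun _ : ℝ => c) a T := fun c =>
    (LipschitzWith.const c).lipschitzOnWith.absolutelyContinuousOnInterval
  have hUac : ∀ i, AbsolutelyContinuousOnInterval (U i) a T := fun i =>
    (hcst _).add ((hui i).absolutelyContinuousOnInterval_integral_complex hmem)
  have hVac : ∀ i, AbsolutelyContinuousOnInterval (V i) a T := fun i =>
    (hcst _).add ((hvi i).absolutelyContinuousOnInterval_integral_complex hmem)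
  have hF := ((hUac 1).smul (hVac 0)).sub ((hUac 0).smul (hVac 1))
  have hcont : ∀ i, ContinuousOn (U i) (uIcc a T) := fun i => (hUac i).continuousOn
  have hcontV : ∀ i, ContinuousOn (V i) (uIcc a T) := fun i => (hVac i).continuousOn
  set g : ℝ → ℂ := fun s =>
    (rowMul u (hamKernel H z) 1 s * V 0 s + U 1 s * rowMul v (hamKernel H w) 0 s) -
    (rowMul u (hamKernel H z) 0 s * V 1 s + U 0 s * rowMul v (hamKernel H w) 1 s) with hg
  have hgi : IntervalIntegrable g volume a T :=
    (((hui 1).mul_continuousOn (hcontV 0)).add ((hvi 0).continuousOn_mul (hcont 1))).sub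
      (((hui 0).mul_continuousOn (hcontV 1)).add ((hvi 1).continuousOn_mul (hcont 0)))
  have hd : ∀ᵐ x, x ∈ uIcc a T → HasDerivAt (U 1 • V 0 - U 0 • V 1) (g x) x := by
    filter_upwards [(hui 0).ae_hasDerivAt_integral, (hui 1).ae_hasDerivAt_integral,
      (hvi 0).ae_hasDerivAt_integral, (hvi 1).ae_hasDerivAt_integral] with x h0 h1 h2 h3 hx
    have hU0 : HasDerivAt (U 0) _ x := (h0 hx a hmem).const_add (u a 0)
    have hU1 : HasDerivAt (U 1) _ x := (h1 hx a hmem).const_add (u a 1)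
    have hV0 : HasDerivAt (V 0) _ x := (h2 hx a hmem).const_add (v a 0)
    have hV1 : HasDerivAt (V 1) _ x := (h3 hx a hmem).const_add (v a 1)
    exact (hU1.mul hV0).sub (hU0.mul hV1)
  have hI := hF.integral_eq_sub_of_ae_hasDerivAt hgi
    (hgi.absolutelyContinuousOnInterval_integral_complex hmem) hd
  have hT : T ∈ Icc a T := right_mem_Icc.2 haT
  have ha : a ∈ Icc a T := left_mem_Icc.2 haT
  simp only [Pi.sub_apply, Pi.mul_apply, smul_eq_mul, hUu _ _ hT, hUu _ _ ha, hVv _ _ hT,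
    hVv _ _ ha] at hI
  rw [← hI]
  refine intervalIntegral.integral_congr_ae ?_
  filter_upwards [hsymm] with s hs hsm
  have hsm' : s ∈ Icc a T := by
    rw [uIoc_of_le haT] at hsm
    exact Ioc_subset_Icc_self hsm
  simp only [hg, hUu _ _ hsm', hVv _ _ hsm', rowMul, hamKernel, hs hsm']
  simp only [one_ne_zero, if_true, if_false]
  ring

/-- The Hermitian form of a real symmetric `2 × 2` matrix. -/
def hermForm (A : Matrix (Fin 2) (Fin 2) ℝ) (x y : ℂ) : ℝ :=
  A 0 0 * Complex.normSq x + 2 * A 0 1 * (x * starRingEnd ℂ y).re + A 1 1 * Complex.normSq y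

theorem IsRowSolution.im_identity (hu : IsRowSolution H z a T u)
    (haT : a ≤ T) (hH : ∀ i j, IntervalIntegrable (fun s => H s i j) volume a T)
    (hsymm : ∀ᵐ s, s ∈ Icc a T → H s 1 0 = H s 0 1) :
    z.im * ∫ s in a..T, hermForm (H s) (u s 0) (u s 1) =
      (u T 1 * starRingEnd ℂ (u T 0)).im - (u a 1 * starRingEnd ℂ (u a 0)).im := by
  have h := hu.lagrange hu.conj haT hH hsymm
  have h2 : ∀ s, (z - starRingEnd ℂ z) * (u s 0 * H s 0 0 * starRingEnd ℂ (u s 0) +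
      u s 0 * H s 0 1 * starRingEnd ℂ (u s 1) + u s 1 * H s 0 1 * starRingEnd ℂ (u s 0) +
      u s 1 * H s 1 1 * starRingEnd ℂ (u s 1)) =
      (2 * z.im * Complex.I) * (hermForm (H s) (u s 0) (u s 1) : ℝ) := by
    intro s
    apply Complex.ext
    · simp [hermForm, Complex.normSq_apply]
      right
      ring
    · simp [hermForm, Complex.normSq_apply]
      ring
  simp only [h2] at h
  rw [intervalIntegral.integral_const_mul, intervalIntegral.integral_ofReal] at h
  have h3 := congrArg Complex.im h
  simp only [Complex.mul_im, Complex.mul_re, Complex.sub_im, Complex.conj_re, Complex.conj_im,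
    Complex.I_re, Complex.I_im, Complex.ofReal_re, Complex.ofReal_im, Complex.re_ofNat,
    Complex.im_ofNat] at h3 ⊢
  linarith

end RowSolutions

section WeylEstimate

theorem sq_norm_integral_le_of_sq_norm_le_mul {f : ℝ → ℂ} {A B : ℝ → ℝ} {a T : ℝ} (haT : a ≤ T)
    (hf : IntervalIntegrable f volume a T) (hA : IntervalIntegrable A volume a T)
    (hB : IntervalIntegrable B volume a T)
    (h : ∀ᵐ s, s ∈ Icc a T → 0 ≤ A s ∧ 0 ≤ B s ∧ ‖f s‖ ^ 2 ≤ A s * B s) :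
    ‖∫ s in a..T, f s‖ ^ 2 ≤ (∫ s in a..T, A s) * ∫ s in a..T, B s := by
  have hpt : ∀ x : ℝ, 0 ≤ (∫ s in a..T, A s) * (x * x) + (-2 * ∫ s in a..T, ‖f s‖) * x +
      ∫ s in a..T, B s := by
    intro x
    have h1 : ∫ s in a..T, (A s * (x * x) + (-2 * ‖f s‖) * x + B s) =
        (∫ s in a..T, A s) * (x * x) + (-2 * ∫ s in a..T, ‖f s‖) * x + ∫ s in a..T, B s := by
      have hfi := (hf.norm.const_mul (-2)).mul_const x
      rw [intervalIntegral.integral_add ((hA.mul_const _).add hfi) hB,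
        intervalIntegral.integral_add (hA.mul_const _) hfi, intervalIntegral.integral_mul_const,
        intervalIntegral.integral_mul_const, intervalIntegral.integral_const_mul]
    rw [← h1]
    refine intervalIntegral.integral_nonneg_of_ae_restrict haT ?_
    rw [EventuallyLE, ae_restrict_iff' measurableSet_Icc]
    filter_upwards [h] with s hs hsm
    obtain ⟨hA0, hB0, hfs⟩ := hs hsm
    have hn := norm_nonneg (f s)
    simp only [Pi.zero_apply]
    rcases hA0.eq_or_lt with h0 | h0
    · have : ‖f s‖ = 0 := by rw [← h0] at hfs; nlinarith
      rw [← h0, this]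
      simpa using hB0
    · have : 0 ≤ A s * (A s * (x * x) + (-2 * ‖f s‖) * x + B s) := by
        nlinarith [sq_nonneg (A s * x - ‖f s‖)]
      exact nonneg_of_mul_nonneg_right this h0
  have hd := discrim_le_zero hpt
  rw [discrim] at hd
  have h2 : ‖∫ s in a..T, f s‖ ^ 2 ≤ (∫ s in a..T, ‖f s‖) ^ 2 :=
    pow_le_pow_left₀ (norm_nonneg _) (intervalIntegral.norm_integral_le_integral_norm haT) 2
  linarith

/-- Nonnegativity of a real symmetric `2 × 2` matrix in terms of its entries. -/
structure EntryPSD (A : Matrix (Fin 2) (Fin 2) ℝ) : Prop where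
  symm : A 1 0 = A 0 1
  nonneg₀ : 0 ≤ A 0 0
  nonneg₁ : 0 ≤ A 1 1
  det_nonneg : A 0 1 ^ 2 ≤ A 0 0 * A 1 1

theorem EntryPSD.form_nonneg {A : Matrix (Fin 2) (Fin 2) ℝ} (hA : EntryPSD A) (x y : ℝ) :
    0 ≤ A 0 0 * x ^ 2 + 2 * A 0 1 * (x * y) + A 1 1 * y ^ 2 := by
  obtain ⟨-, h0, h1, hd⟩ := hA
  rcases h0.eq_or_lt with h | h
  · have h01 : A 0 1 = 0 := by rw [← h] at hd; nlinarith
    rw [← h, h01]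
    nlinarith [mul_nonneg h1 (sq_nonneg y)]
  · have : 0 ≤ A 0 0 * (A 0 0 * x ^ 2 + 2 * A 0 1 * (x * y) + A 1 1 * y ^ 2) := by
      nlinarith [sq_nonneg (A 0 0 * x + A 0 1 * y), mul_nonneg (sub_nonneg.2 hd) (sq_nonneg y)]
    exact nonneg_of_mul_nonneg_right this h

theorem Matrix.PosSemidef.entryPSD {A : Matrix (Fin 2) (Fin 2) ℝ} (hA : A.PosSemidef) :
    EntryPSD A := by
  have hsymm : A 1 0 = A 0 1 := by simpa using hA.isHermitian.apply 0 1
  have hq : ∀ x y : ℝ, 0 ≤ A 0 0 * x ^ 2 + 2 * A 0 1 * (x * y) + A 1 1 * y ^ 2 := by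
    intro x y
    have := hA.dotProduct_mulVec_nonneg ![x, y]
    simp [Matrix.mulVec, dotProduct, Fin.sum_univ_two, hsymm] at this
    linarith
  refine ⟨hsymm, by simpa using hq 1 0, by simpa using hq 0 1, ?_⟩
  have := discrim_le_zero (a := A 0 0) (b := 2 * A 0 1) (c := A 1 1) fun x => by
    have := hq x 1
    linarith
  rw [discrim] at this
  linarith

theorem hermForm_nonneg {A : Matrix (Fin 2) (Fin 2) ℝ} (hA : EntryPSD A) (x y : ℂ) :
    0 ≤ hermForm A x y := by
  have h1 := hA.form_nonneg x.re y.re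
  have h2 := hA.form_nonneg x.im y.im
  simp only [hermForm, Complex.normSq_apply, Complex.mul_re, Complex.conj_re, Complex.conj_im]
  linarith

theorem norm_sq_le_hermForm₁ {A : Matrix (Fin 2) (Fin 2) ℝ} (hA : EntryPSD A) (x y : ℂ) :
    ‖x * A 0 1 + y * A 1 1‖ ^ 2 ≤ A 1 1 * hermForm A x y := by
  rw [← Complex.normSq_eq_norm_sq]
  simp only [hermForm, Complex.normSq_apply, Complex.add_re, Complex.add_im, Complex.mul_re,
    Complex.mul_im, Complex.ofReal_re, Complex.ofReal_im, Complex.conj_re, Complex.conj_im]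
  nlinarith [mul_nonneg (sub_nonneg.2 hA.det_nonneg) (sq_nonneg x.re),
    mul_nonneg (sub_nonneg.2 hA.det_nonneg) (sq_nonneg x.im)]

theorem norm_sq_le_hermForm₀ {A : Matrix (Fin 2) (Fin 2) ℝ} (hA : EntryPSD A) (x y : ℂ) :
    ‖x * A 0 0 + y * A 0 1‖ ^ 2 ≤ A 0 0 * hermForm A x y := by
  rw [← Complex.normSq_eq_norm_sq]
  simp only [hermForm, Complex.normSq_apply, Complex.add_re, Complex.add_im, Complex.mul_re,
    Complex.mul_im, Complex.ofReal_re, Complex.ofReal_im, Complex.conj_re, Complex.conj_im]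
  nlinarith [mul_nonneg (sub_nonneg.2 hA.det_nonneg) (sq_nonneg y.re),
    mul_nonneg (sub_nonneg.2 hA.det_nonneg) (sq_nonneg y.im)]

theorem hermForm_le_three_mul {A : Matrix (Fin 2) (Fin 2) ℝ} (hA : EntryPSD A) (x y p q : ℂ) :
    hermForm A p q ≤ 3 * (hermForm A x y + A 0 0 * ‖x - p‖ ^ 2 + A 1 1 * ‖y - q‖ ^ 2) := by
  have key : ∀ x y p q : ℝ, A 0 0 * p ^ 2 + 2 * A 0 1 * (p * q) + A 1 1 * q ^ 2 ≤
      3 * ((A 0 0 * x ^ 2 + 2 * A 0 1 * (x * y) + A 1 1 * y ^ 2) + A 0 0 * (x - p) ^ 2 +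
        A 1 1 * (y - q) ^ 2) := by
    intro x y p q
    nlinarith [hA.form_nonneg (x + (x - p)) y, hA.form_nonneg x (y + (y - q)),
      hA.form_nonneg (x - p) (-(y - q))]
  have h1 := key x.re y.re p.re q.re
  have h2 := key x.im y.im p.im q.im
  rw [← Complex.normSq_eq_norm_sq, ← Complex.normSq_eq_norm_sq]
  simp only [hermForm, Complex.normSq_apply, Complex.mul_re, Complex.conj_re, Complex.conj_im,
    Complex.sub_re, Complex.sub_im]
  linarith

variable {H : ℝ → Matrix (Fin 2) (Fin 2) ℝ} {z : ℂ} {a T r : ℝ} {u v : ℝ → Fin 2 → ℂ}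

theorem intervalIntegrable_hermForm
    (hH : ∀ i j, IntervalIntegrable (fun s => H s i j) volume a T) (haT : a ≤ T)
    (hu : ∀ i, ContinuousOn (fun t => u t i) (Icc a T)) :
    IntervalIntegrable (fun s => hermForm (H s) (u s 0) (u s 1)) volume a T := by
  rw [← uIcc_of_le haT] at hu
  have h0 : ContinuousOn (fun s => Complex.normSq (u s 0)) (uIcc a T) :=
    Complex.continuous_normSq.comp_continuousOn (hu 0)
  have h1 : ContinuousOn (fun s => Complex.normSq (u s 1)) (uIcc a T) :=
    Complex.continuous_normSq.comp_continuousOn (hu 1)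
  have h2 : ContinuousOn (fun s => (u s 0 * starRingEnd ℂ (u s 1)).re) (uIcc a T) :=
    Complex.continuous_re.comp_continuousOn
      ((hu 0).mul (Complex.continuous_conj.comp_continuousOn (hu 1)))
  exact (((hH 0 0).mul_continuousOn h0).add
    (((hH 0 1).const_mul 2).mul_continuousOn h2)).add ((hH 1 1).mul_continuousOn h1)

theorem integral_hermForm_const
    (hH : ∀ i j, IntervalIntegrable (fun s => H s i j) volume a T) (x y : ℂ) :
    ∫ s in a..T, hermForm (H s) x y = m1 a H T * Complex.normSq x +
      2 * m3 a H T * (x * starRingEnd ℂ y).re + m2 a H T * Complex.normSq y := by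
  unfold hermForm m1 m2 m3
  rw [intervalIntegral.integral_add (((hH 0 0).mul_const _).add
      (((hH 0 1).const_mul 2).mul_const _)) ((hH 1 1).mul_const _),
    intervalIntegral.integral_add ((hH 0 0).mul_const _) (((hH 0 1).const_mul 2).mul_const _)]
  simp only [intervalIntegral.integral_mul_const, intervalIntegral.integral_const_mul]

/-- A row solution whose quadratic form has small integral stays close to its initial value. -/
theorem IsRowSolution.integral_hermForm_init_le (hu : IsRowSolution H z a T u) (haT : a ≤ T)
    (hH : ∀ i j, IntervalIntegrable (fun s => H s i j) volume a T)
    (hpsd : ∀ᵐ s, s ∈ Icc a T → EntryPSD (H s)) :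
    ∫ s in a..T, hermForm (H s) (u a 0) (u a 1) ≤
      3 * (1 + 2 * (‖z‖ ^ 2 * (m1 a H T * m2 a H T))) *
        ∫ s in a..T, hermForm (H s) (u s 0) (u s 1) := by
  have hQ := intervalIntegrable_hermForm hH haT (fun i => hu.continuousOn haT hH i)
  set E := ∫ s in a..T, hermForm (H s) (u s 0) (u s 1) with hE
  have hsub : ∀ {t}, t ∈ Icc a T → uIcc a t ⊆ uIcc a T := fun ht => by
    rw [uIcc_of_le ht.1, uIcc_of_le haT]; exact Icc_subset_Icc_right ht.2
  have hpsd' : ∀ {t}, t ∈ Icc a T → ∀ᵐ s, s ∈ Icc a t → EntryPSD (H s) := fun ht => by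
    filter_upwards [hpsd] with s hs hs' using hs ⟨hs'.1, hs'.2.trans ht.2⟩
  have hmono : ∀ g : ℝ → ℝ, IntervalIntegrable g volume a T →
      (∀ᵐ s, s ∈ Icc a T → 0 ≤ g s) → ∀ t ∈ Icc a T,
      ∫ s in a..t, g s ≤ ∫ s in a..T, g s := by
    intro g hg h0 t ht
    refine intervalIntegral.integral_mono_interval le_rfl ht.1 ht.2 ?_ hg
    rw [EventuallyLE, ae_restrict_iff' measurableSet_Ioc]
    filter_upwards [h0] with s hs hs' using hs (Ioc_subset_Icc_self hs')
  have hnn : ∀ g : ℝ → ℝ, (∀ᵐ s, s ∈ Icc a T → 0 ≤ g s) → ∀ t ∈ Icc a T,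
      0 ≤ ∫ s in a..t, g s := by
    intro g h0 t ht
    refine intervalIntegral.integral_nonneg_of_ae_restrict ht.1 ?_
    rw [EventuallyLE, ae_restrict_iff' measurableSet_Icc]
    filter_upwards [h0] with s hs hs' using hs ⟨hs'.1, hs'.2.trans ht.2⟩
  have hQ0 : ∀ᵐ s, s ∈ Icc a T → 0 ≤ hermForm (H s) (u s 0) (u s 1) := by
    filter_upwards [hpsd] with s hs hs' using hermForm_nonneg (hs hs') _ _
  have h00 : ∀ᵐ s, s ∈ Icc a T → 0 ≤ H s 0 0 := by
    filter_upwards [hpsd] with s hs hs' using (hs hs').nonneg₀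
  have h11 : ∀ᵐ s, s ∈ Icc a T → 0 ≤ H s 1 1 := by
    filter_upwards [hpsd] with s hs hs' using (hs hs').nonneg₁
  have hδ0 : ∀ t ∈ Icc a T, ‖u t 0 - u a 0‖ ^ 2 ≤ ‖z‖ ^ 2 * (m2 a H T * E) := by
    intro t ht
    have h1 : u t 0 - u a 0 =
        -z * ∫ s in a..t, (u s 0 * H s 0 1 + u s 1 * H s 1 1) := by
      rw [hu t ht 0, add_sub_cancel_left, ← intervalIntegral.integral_const_mul]
      congr 1
      ext s
      simp only [rowMul, hamKernel, if_true]
      ring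
    rw [h1, norm_mul, norm_neg, mul_pow]
    gcongr
    refine (sq_norm_integral_le_of_sq_norm_le_mul (A := fun s => H s 1 1)
      (B := fun s => hermForm (H s) (u s 0) (u s 1)) ht.1 ?_ ((hH 1 1).mono_set (hsub ht))
      (hQ.mono_set (hsub ht)) ?_).trans ?_
    · have hc := fun i => (hu.continuousOn haT hH i).mono (Icc_subset_Icc_right ht.2)
      rw [← uIcc_of_le ht.1] at hc
      have hr : ∀ i j, IntervalIntegrable (fun s => (H s i j : ℂ)) volume a t := fun i j =>
        ⟨((hH i j).mono_set (hsub ht)).1.ofReal, ((hH i j).mono_set (hsub ht)).2.ofReal⟩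
      exact ((hr 0 1).continuousOn_mul (hc 0)).add ((hr 1 1).continuousOn_mul (hc 1))
    · filter_upwards [hpsd' ht] with s hs hs'
      exact ⟨(hs hs').nonneg₁, hermForm_nonneg (hs hs') _ _, norm_sq_le_hermForm₁ (hs hs') _ _⟩
    · exact mul_le_mul (hmono _ (hH 1 1) h11 t ht) (hmono _ hQ hQ0 t ht) (hnn _ hQ0 t ht)
        (hnn _ h11 T (right_mem_Icc.2 haT))
  have hδ1 : ∀ t ∈ Icc a T, ‖u t 1 - u a 1‖ ^ 2 ≤ ‖z‖ ^ 2 * (m1 a H T * E) := by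
    intro t ht
    have h1 : ∀ᵐ s, s ∈ uIoc a t → rowMul u (hamKernel H z) 1 s =
        z * (u s 0 * H s 0 0 + u s 1 * H s 0 1) := by
      filter_upwards [hpsd' ht] with s hs hs'
      rw [uIoc_of_le ht.1] at hs'
      simp only [rowMul, hamKernel, one_ne_zero, if_false,
        (hs (Ioc_subset_Icc_self hs')).symm]
      ring
    rw [hu t ht 1, add_sub_cancel_left, intervalIntegral.integral_congr_ae h1,
      intervalIntegral.integral_const_mul, norm_mul, mul_pow]
    gcongr
    refine (sq_norm_integral_le_of_sq_norm_le_mul (A := fun s => H s 0 0)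
      (B := fun s => hermForm (H s) (u s 0) (u s 1)) ht.1 ?_ ((hH 0 0).mono_set (hsub ht))
      (hQ.mono_set (hsub ht)) ?_).trans ?_
    · have hc := fun i => (hu.continuousOn haT hH i).mono (Icc_subset_Icc_right ht.2)
      rw [← uIcc_of_le ht.1] at hc
      have hr : ∀ i j, IntervalIntegrable (fun s => (H s i j : ℂ)) volume a t := fun i j =>
        ⟨((hH i j).mono_set (hsub ht)).1.ofReal, ((hH i j).mono_set (hsub ht)).2.ofReal⟩
      exact ((hr 0 0).continuousOn_mul (hc 0)).add ((hr 0 1).continuousOn_mul (hc 1))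
    · filter_upwards [hpsd' ht] with s hs hs'
      exact ⟨(hs hs').nonneg₀, hermForm_nonneg (hs hs') _ _, norm_sq_le_hermForm₀ (hs hs') _ _⟩
    · exact mul_le_mul (hmono _ (hH 0 0) h00 t ht) (hmono _ hQ hQ0 t ht) (hnn _ hQ0 t ht)
        (hnn _ h00 T (right_mem_Icc.2 haT))
  have hbd : ∫ s in a..T, hermForm (H s) (u a 0) (u a 1) ≤
      ∫ s in a..T, 3 * (hermForm (H s) (u s 0) (u s 1) + H s 0 0 * (‖z‖ ^ 2 * (m2 a H T * E)) +
        H s 1 1 * (‖z‖ ^ 2 * (m1 a H T * E))) := by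
    refine intervalIntegral.integral_mono_ae_restrict haT
      (intervalIntegrable_hermForm (u := fun _ => u a) hH haT fun i => continuousOn_const)
      (((hQ.add ((hH 0 0).mul_const _)).add ((hH 1 1).mul_const _)).const_mul 3) ?_
    rw [EventuallyLE, ae_restrict_iff' measurableSet_Icc]
    filter_upwards [hpsd] with s hs hsm
    have h1 := hermForm_le_three_mul (hs hsm) (u s 0) (u s 1) (u a 0) (u a 1)
    have h2 := mul_le_mul_of_nonneg_left (hδ0 s hsm) (hs hsm).nonneg₀
    have h3 := mul_le_mul_of_nonneg_left (hδ1 s hsm) (hs hsm).nonneg₁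
    linarith
  refine hbd.trans (le_of_eq ?_)
  rw [intervalIntegral.integral_const_mul, intervalIntegral.integral_add
      (hQ.add ((hH 0 0).mul_const _)) ((hH 1 1).mul_const _),
    intervalIntegral.integral_add hQ ((hH 0 0).mul_const _),
    intervalIntegral.integral_mul_const, intervalIntegral.integral_mul_const]
  change 3 * (E + m1 a H T * _ + m2 a H T * _) = _
  ring

/-- The basic inequality for the approximating Weyl quotients on the imaginary axis. -/
theorem weyl_quotient_estimate {t : ℝ} (haT : a ≤ T) (hTt : T ≤ t) (hr : 0 < r)
    (hH : ∀ i j, IntervalIntegrable (fun s => H s i j) volume a t)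
    (hpsd : ∀ᵐ s, s ∈ Icc a t → EntryPSD (H s))
    (hu : IsRowSolution H (r * Complex.I) a t u) (hv : IsRowSolution H (r * Complex.I) a t v)
    (hu0 : u a 0 = 1) (hu1 : u a 1 = 0) (hv0 : v a 0 = 0) (hv1 : v a 1 = 1)
    (hm : r ^ 2 * (m1 a H T * m2 a H T) = 1) {τ : ℂ}
    (hτ : τ = (u t 0 * Complex.I + u t 1) / (v t 0 * Complex.I + v t 1)) :
    m1 a H T - 2 * m3 a H T * τ.re + m2 a H T * Complex.normSq τ ≤ 9 * (τ.im / r) := by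
  have hat := haT.trans hTt
  have him : ((r : ℂ) * Complex.I).im = r := by simp
  have hsymm : ∀ᵐ s, s ∈ Icc a t → H s 1 0 = H s 0 1 := by
    filter_upwards [hpsd] with s hs hs' using (hs hs').symm
  have hnn : ∀ {w : ℝ → Fin 2 → ℂ}, 0 ≤ ∫ s in a..t, hermForm (H s) (w s 0) (w s 1) := by
    intro w
    refine intervalIntegral.integral_nonneg_of_ae_restrict hat ?_
    rw [EventuallyLE, ae_restrict_iff' measurableSet_Icc]
    filter_upwards [hpsd] with s hs hs' using hermForm_nonneg (hs hs') _ _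
  have hden : v t 0 * Complex.I + v t 1 ≠ 0 := by
    intro h0
    have hv1' : v t 1 = -(v t 0 * Complex.I) := by linear_combination h0
    have h1 := hv.im_identity hat hH hsymm
    have h2 : (v t 1 * starRingEnd ℂ (v t 0)).im = -Complex.normSq (v t 0) := by
      rw [hv1']
      simp [Complex.normSq_apply]
      ring
    rw [him, h2, hv0] at h1
    simp only [map_zero, mul_zero, Complex.zero_im, sub_zero] at h1
    have h3 := mul_nonneg hr.le (hnn (w := v))
    have h4 : v t 0 = 0 := by
      rw [← Complex.normSq_eq_zero]
      exact le_antisymm (by linarith) (Complex.normSq_nonneg _)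
    have h5 := hu.lagrange hv hat hH hsymm
    rw [hv1', h4, hu0, hu1, hv0, hv1] at h5
    simp at h5
  set y : ℝ → Fin 2 → ℂ := fun s => u s - τ • v s with hy
  have hys : IsRowSolution H (r * Complex.I) a t y := hu.sub_smul hv hat hH τ
  have hya0 : y a 0 = 1 := by simp [hy, hu0, hv0]
  have hya1 : y a 1 = -τ := by simp [hy, hu1, hv1]
  have hyt : y t 1 = -(y t 0 * Complex.I) := by
    have h1 : τ * (v t 0 * Complex.I + v t 1) = u t 0 * Complex.I + u t 1 := by
      rw [hτ, div_mul_cancel₀ _ hden]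
    simp only [hy, Pi.sub_apply, Pi.smul_apply, smul_eq_mul]
    linear_combination (-1 : ℂ) * h1
  have h1 := hys.im_identity hat hH hsymm
  have h2 : (y t 1 * starRingEnd ℂ (y t 0)).im = -Complex.normSq (y t 0) := by
    rw [hyt]
    simp [Complex.normSq_apply]
    ring
  rw [him, h2, hya0, hya1] at h1
  simp only [map_one, mul_one, Complex.neg_im] at h1
  have hsub : uIcc a T ⊆ uIcc a t := by
    rw [uIcc_of_le haT, uIcc_of_le hat]; exact Icc_subset_Icc_right hTt
  have hHT : ∀ i j, IntervalIntegrable (fun s => H s i j) volume a T := fun i j =>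
    (hH i j).mono_set hsub
  have hQ := intervalIntegrable_hermForm hH hat (fun i => hys.continuousOn hat hH i)
  have hE : ∫ s in a..T, hermForm (H s) (y s 0) (y s 1) ≤ τ.im / r := by
    rw [le_div_iff₀ hr]
    have h3 : ∫ s in a..T, hermForm (H s) (y s 0) (y s 1) ≤
        ∫ s in a..t, hermForm (H s) (y s 0) (y s 1) := by
      refine intervalIntegral.integral_mono_interval le_rfl haT hTt ?_ hQ
      rw [EventuallyLE, ae_restrict_iff' measurableSet_Ioc]
      filter_upwards [hpsd] with s hs hs' using
        hermForm_nonneg (hs (Ioc_subset_Icc_self hs')) _ _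
    have h4 := mul_le_mul_of_nonneg_left h3 hr.le
    have h5 := Complex.normSq_nonneg (y t 0)
    linarith
  have h6 := (hys.mono hTt).integral_hermForm_init_le haT hHT (by
    filter_upwards [hpsd] with s hs hs' using hs ⟨hs'.1, hs'.2.trans hTt⟩)
  rw [integral_hermForm_const hHT, hya0, hya1] at h6
  have h7 : ‖(r : ℂ) * Complex.I‖ = r := by simp [abs_of_pos hr]
  rw [h7, hm] at h6
  simp only [map_one, mul_one, one_mul, map_neg, Complex.neg_re, Complex.conj_re,
    Complex.normSq_neg] at h6
  linarith

end WeylEstimate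

section WeylCoefficient

variable {a : ℝ} {b : EReal} {H : ℝ → Matrix (Fin 2) (Fin 2) ℝ}

theorem IsHamiltonian.ae_entryPSD (hH : IsHamiltonian a b H) :
    ∀ᵐ t : ℝ, a ≤ t → (t : EReal) < b → EntryPSD (H t) := by
  filter_upwards [hH.posSemidef] with t ht h1 h2 using (ht h1 h2).entryPSD

theorem IsHamiltonian.ae_entryPSD_Icc (hH : IsHamiltonian a b H) {T : ℝ} (hT : (T : EReal) < b) :
    ∀ᵐ t : ℝ, t ∈ Icc a T → EntryPSD (H t) := by
  filter_upwards [hH.ae_entryPSD] with t ht h1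
  exact ht h1.1 (lt_of_le_of_lt (EReal.coe_le_coe_iff.2 h1.2) hT)

theorem IsFundamentalSolution.isRowSolution {W : ℝ → ℂ → Matrix (Fin 2) (Fin 2) ℂ}
    (hW : IsFundamentalSolution a b H W) {T : ℝ} (haT : a ≤ T) (hT : (T : EReal) < b) (z : ℂ)
    (i : Fin 2) :
    IsRowSolution H z a T (fun t => W t z i) ∧
      ∀ j, W a z i j = (1 : Matrix (Fin 2) (Fin 2) ℂ) i j := by
  have hlt : ∀ t ∈ Icc a T, (t : EReal) < b := fun t ht =>
    lt_of_le_of_lt (EReal.coe_le_coe_iff.2 ht.2) hT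
  have key : ∀ t ∈ Icc a T, ∀ j, W t z i j = (1 : Matrix (Fin 2) (Fin 2) ℂ) i j +
      ∫ s in a..t, rowMul (fun t => W t z i) (hamKernel H z) j s := by
    intro t ht j
    have hi : i = 0 ∨ i = 1 := by fin_cases i <;> simp
    have h := hW z t ht.1 (hlt t ht)
    have h0 := congrFun (congrFun h i) 0
    have h1 := congrFun (congrFun h i) 1
    simp only [JmatC, Matrix.sub_apply, Matrix.mul_apply, Fin.sum_univ_two, Matrix.smul_apply,
      Matrix.of_apply, Matrix.map_apply, Matrix.cons_val', Matrix.cons_val_zero,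
      Matrix.cons_val_one, Matrix.cons_val_fin_one, smul_eq_mul] at h0 h1
    have hk0 : ∫ s in a..t, rowMul (fun t => W t z i) (hamKernel H z) 0 s =
        -(z * ∫ s in a..t, (W s z i 0 * H s 0 1 + W s z i 1 * H s 1 1)) := by
      rw [← intervalIntegral.integral_const_mul, ← intervalIntegral.integral_neg]
      congr 1
      ext s
      simp only [rowMul, hamKernel, if_true]
      ring
    have hk1 : ∫ s in a..t, rowMul (fun t => W t z i) (hamKernel H z) 1 s =
        z * ∫ s in a..t, (W s z i 0 * H s 0 0 + W s z i 1 * H s 1 0) := by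
      rw [← intervalIntegral.integral_const_mul]
      congr 1
      ext s
      simp only [rowMul, hamKernel, one_ne_zero, if_false]
      ring
    match j with
    | 0 =>
      rw [hk0, ← h1]
      rcases hi with rfl | rfl <;> simp
    | 1 =>
      rw [hk1, ← h0]
      rcases hi with rfl | rfl <;> simp
  have hWa : ∀ j, W a z i j = (1 : Matrix (Fin 2) (Fin 2) ℂ) i j := fun j => by
    simpa using key a (left_mem_Icc.2 haT) j
  refine ⟨fun t ht j => (key t ht j).trans ?_, hWa⟩
  rw [← hWa]

theorem neBot_toBFilter (hab : (a : EReal) < b) : (toBFilter b).NeBot := by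
  refine comap_neBot fun s hs => ?_
  obtain ⟨c, hc, hcs⟩ := (mem_nhdsLT_iff_exists_Ioo_subset' hab).1 hs
  obtain ⟨x, h1, h2⟩ := EReal.lt_iff_exists_real_btwn.1 hc
  exact ⟨x, hcs ⟨h1, h2⟩⟩

theorem eventually_toBFilter {T : ℝ} (hT : (T : EReal) < b) :
    ∀ᶠ t : ℝ in toBFilter b, T < t ∧ (t : EReal) < b := by
  have h : Ioo (T : EReal) b ∈ nhdsWithin b (Iio b) := Ioo_mem_nhdsLT hT
  filter_upwards [preimage_mem_comap h] with t ht
  exact ⟨EReal.coe_lt_coe_iff.1 ht.1, ht.2⟩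

/-- The basic inequality for the Weyl coefficient on the imaginary axis. -/
theorem IsWeylCoefficient.estimate {qH : ℂ → ℂ} (hH : IsHamiltonian a b H)
    (hq : IsWeylCoefficient a b H qH) {T r : ℝ} (haT : a ≤ T) (hT : (T : EReal) < b) (hr : 0 < r)
    (hm : r ^ 2 * (m1 a H T * m2 a H T) = 1) :
    m1 a H T - 2 * m3 a H T * (qH (r * Complex.I)).re +
      m2 a H T * Complex.normSq (qH (r * Complex.I)) ≤ 9 * ((qH (r * Complex.I)).im / r) := by
  obtain ⟨W, hW, hlim⟩ := hq
  have hlim' := hlim (r * Complex.I) (by simpa using hr.ne') Complex.I (by simp)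
  have : (toBFilter b).NeBot := neBot_toBFilter hH.a_lt_b
  have hcont : Continuous fun τ : ℂ => 9 * (τ.im / r) -
      (m1 a H T - 2 * m3 a H T * τ.re + m2 a H T * Complex.normSq τ) := by
    have := Complex.continuous_normSq
    fun_prop
  rw [← sub_nonneg]
  refine ge_of_tendsto ((hcont.tendsto _).comp hlim') ?_
  filter_upwards [eventually_toBFilter hT] with t ht
  have hat : a ≤ t := haT.trans ht.1.le
  obtain ⟨hu, hu'⟩ := hW.isRowSolution hat ht.2 (r * Complex.I) 0
  obtain ⟨hv, hv'⟩ := hW.isRowSolution hat ht.2 (r * Complex.I) 1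
  exact sub_nonneg.2 (weyl_quotient_estimate haT ht.1.le hr
    (fun i j => hH.locInt i j t hat ht.2) (hH.ae_entryPSD_Icc ht.2) hu hv (by simp [hu'])
    (by simp [hu']) (by simp [hv']) (by simp [hv']) hm rfl)

end WeylCoefficient

section PrimitiveEntries

variable {a : ℝ} {b : EReal} {H : ℝ → Matrix (Fin 2) (Fin 2) ℝ}

theorem IsHamiltonian.m3_sq_le (hH : IsHamiltonian a b H) {T : ℝ} (haT : a ≤ T)
    (hT : (T : EReal) < b) : m3 a H T ^ 2 ≤ m1 a H T * m2 a H T := by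
  have h := sq_norm_integral_le_of_sq_norm_le_mul (f := fun s => (H s 0 1 : ℂ))
    (A := fun s => H s 0 0) (B := fun s => H s 1 1) haT
    ⟨(hH.locInt 0 1 T haT hT).1.ofReal, (hH.locInt 0 1 T haT hT).2.ofReal⟩
    (hH.locInt 0 0 T haT hT) (hH.locInt 1 1 T haT hT) (by
      filter_upwards [hH.ae_entryPSD_Icc hT] with s hs hsm
      refine ⟨(hs hsm).nonneg₀, (hs hsm).nonneg₁, ?_⟩
      simpa using (hs hsm).det_nonneg)
  rw [intervalIntegral.integral_ofReal] at h
  simpa [m1, m2, m3] using h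

theorem intervalIntegral_pos_of_not_ae_zero {g : ℝ → ℝ} {T : ℝ} (haT : a ≤ T)
    (hg : IntervalIntegrable g volume a T) (h0 : ∀ᵐ s, s ∈ Icc a T → 0 ≤ g s)
    (hne : ¬ ∀ᵐ s ∂volume.restrict (Ioo a T), g s = 0) : 0 < ∫ s in a..T, g s := by
  have h0' : 0 ≤ᵐ[volume.restrict (Ioc a T)] g := by
    rw [EventuallyLE, ae_restrict_iff' measurableSet_Ioc]
    filter_upwards [h0] with s hs hs' using hs (Ioc_subset_Icc_self hs')
  refine lt_of_le_of_ne (intervalIntegral.integral_nonneg_of_ae_restrict haT ?_) fun h => hne ?_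
  · rwa [Measure.restrict_congr_set Ioc_ae_eq_Icc] at h0'
  · have := (intervalIntegral.integral_eq_zero_iff_of_le_of_nonneg_ae haT h0' hg).1 h.symm
    rwa [Measure.restrict_congr_set Ioo_ae_eq_Ioc]

theorem IsHamiltonian.m1_pos (hH : IsHamiltonian a b H) (hd : DiagNonVanishing a b H) {T : ℝ}
    (haT : a < T) (hT : (T : EReal) < b) : 0 < m1 a H T :=
  intervalIntegral_pos_of_not_ae_zero haT.le (hH.locInt 0 0 T haT.le hT)
    (by filter_upwards [hH.ae_entryPSD_Icc hT] with s hs hsm using (hs hsm).nonneg₀)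
    (hd.1 T haT hT)

theorem IsHamiltonian.m2_pos (hH : IsHamiltonian a b H) (hd : DiagNonVanishing a b H) {T : ℝ}
    (haT : a < T) (hT : (T : EReal) < b) : 0 < m2 a H T :=
  intervalIntegral_pos_of_not_ae_zero haT.le (hH.locInt 1 1 T haT.le hT)
    (by filter_upwards [hH.ae_entryPSD_Icc hT] with s hs hsm using (hs hsm).nonneg₁)
    (hd.2 T haT hT)

theorem IsHamiltonian.exists_between (hH : IsHamiltonian a b H) :
    ∃ T : ℝ, a < T ∧ (T : EReal) < b := by
  obtain ⟨x, h1, h2⟩ := EReal.lt_iff_exists_real_btwn.1 hH.a_lt_b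
  exact ⟨x, EReal.coe_lt_coe_iff.1 h1, h2⟩

theorem IsHamiltonian.continuousOn_integral_entry (hH : IsHamiltonian a b H) {T : ℝ} (haT : a ≤ T)
    (hT : (T : EReal) < b) (i j : Fin 2) :
    ContinuousOn (fun t => ∫ s in a..t, H s i j) (Icc a T) := by
  have h := intervalIntegral.continuousOn_primitive_interval' (hH.locInt i j T haT hT)
    left_mem_uIcc
  rwa [uIcc_of_le haT] at h

theorem IsHamiltonian.tendsto_integral_entry (hH : IsHamiltonian a b H) (i j : Fin 2) :
    Tendsto (fun t => ∫ s in a..t, H s i j) (𝓝[>] a) (𝓝 0) := by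
  obtain ⟨T, haT, hT⟩ := hH.exists_between
  have h := (hH.continuousOn_integral_entry haT.le hT i j) a (left_mem_Icc.2 haT.le)
  rw [ContinuousWithinAt, intervalIntegral.integral_same] at h
  exact h.mono_left (nhdsWithin_le_of_mem (mem_of_superset (Ioc_mem_nhdsGT haT)
    Ioc_subset_Icc_self))

end PrimitiveEntries

section Herglotz

variable {a : ℝ} {b : EReal} {H : ℝ → Matrix (Fin 2) (Fin 2) ℝ} {μ : Measure ℝ}

/-- The normalised Poisson integral `∫ dμ(x) / (x² + r²)`. -/
def poissonKernelIntegral (μ : Measure ℝ) (r : ℝ) : ℝ≥0∞ :=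
  ∫⁻ x : ℝ, ENNReal.ofReal (1 / (x ^ 2 + r ^ 2)) ∂μ

theorem herglotz_kernel_eq {r : ℝ} (hr : 0 < r) (t : ℝ) :
    1 / ((t : ℂ) - r * Complex.I) - (t : ℂ) / (1 + (t : ℂ) ^ 2) =
      ((t * (1 - r ^ 2) / ((t ^ 2 + r ^ 2) * (1 + t ^ 2)) : ℝ) : ℂ) +
        ((r * (1 / (t ^ 2 + r ^ 2)) : ℝ) : ℂ) * Complex.I := by
  have h1 : (t : ℂ) - r * Complex.I ≠ 0 := by
    intro h
    have := congrArg Complex.im h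
    simp at this
    exact hr.ne' this
  have h2 : ((t : ℂ) ^ 2 + (r : ℂ) ^ 2) ≠ 0 := by
    exact_mod_cast (by positivity : t ^ 2 + r ^ 2 ≠ 0)
  have h3 : (1 + (t : ℂ) ^ 2) ≠ 0 := by
    exact_mod_cast (by positivity : 1 + t ^ 2 ≠ 0)
  push_cast
  field_simp
  ring_nf
  simp only [Complex.I_sq]
  ring

theorem integrable_inv_sq_add_sq
    (hμ : ∫⁻ t : ℝ, ENNReal.ofReal (1 / (1 + t ^ 2)) ∂μ < ⊤) {r : ℝ} (hr : 0 < r) :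
    Integrable (fun t : ℝ => 1 / (t ^ 2 + r ^ 2)) μ := by
  have h1 : Integrable (fun t : ℝ => 1 / (1 + t ^ 2)) μ := by
    refine ⟨(Measurable.aestronglyMeasurable (by fun_prop)), ?_⟩
    rw [hasFiniteIntegral_iff_ofReal (Eventually.of_forall fun t => by positivity)]
    exact hμ
  refine (h1.const_mul (1 + 1 / r ^ 2)).mono' (Measurable.aestronglyMeasurable (by fun_prop))
    (Eventually.of_forall fun t => ?_)
  rw [Real.norm_of_nonneg (by positivity), mul_one_div, div_le_div_iff₀ (by positivity)
    (by positivity)]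
  have : 1 / r ^ 2 * r ^ 2 = 1 := by field_simp
  nlinarith [sq_nonneg t, sq_nonneg r, mul_nonneg (by positivity : 0 ≤ 1 / r ^ 2) (sq_nonneg t)]

theorem integrable_herglotz_re
    (hμ : ∫⁻ t : ℝ, ENNReal.ofReal (1 / (1 + t ^ 2)) ∂μ < ⊤) {r : ℝ} (hr : 0 < r) :
    Integrable (fun t : ℝ => t * (1 - r ^ 2) / ((t ^ 2 + r ^ 2) * (1 + t ^ 2))) μ := by
  have h1 := (integrable_inv_sq_add_sq hμ hr).const_mul |1 - r ^ 2|
  refine h1.mono' (Measurable.aestronglyMeasurable (by fun_prop))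
    (Eventually.of_forall fun t => ?_)
  rw [Real.norm_eq_abs, abs_div, abs_mul, abs_of_pos (by positivity :
    0 < (t ^ 2 + r ^ 2) * (1 + t ^ 2)), mul_one_div, div_le_div_iff₀ (by positivity)
    (by positivity)]
  have h2 : |t| ≤ 1 + t ^ 2 := by
    rw [← sq_abs t]
    nlinarith [sq_nonneg (|t| - 1)]
  have h3 : 0 ≤ |1 - r ^ 2| * (t ^ 2 + r ^ 2) := by positivity
  nlinarith [mul_le_mul_of_nonneg_left h2 h3]

theorem IsSpectralMeasure.exists_weyl (hμ : IsSpectralMeasure a b H μ) :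
    ∃ qH : ℂ → ℂ, IsWeylCoefficient a b H qH ∧ ∃ β : ℝ, 0 ≤ β ∧ ∀ r : ℝ, 0 < r →
      (qH (r * Complex.I)).im / r = β + ∫ x : ℝ, 1 / (x ^ 2 + r ^ 2) ∂μ := by
  obtain ⟨qH, hq, hfin, α, β, hβ, h⟩ := hμ
  refine ⟨qH, hq, β, hβ, fun r hr => ?_⟩
  have h1 := h (r * Complex.I) (by simpa using hr.ne')
  simp only [herglotz_kernel_eq hr] at h1
  have hre := integrable_herglotz_re hfin hr
  have him := (integrable_inv_sq_add_sq hfin hr).const_mul r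
  rw [integral_add hre.ofReal (him.ofReal.mul_const _), integral_mul_const, integral_complex_ofReal,
    integral_complex_ofReal, integral_const_mul] at h1
  rw [h1]
  simp only [Complex.add_im, Complex.mul_im, Complex.ofReal_im, Complex.ofReal_re, Complex.I_re,
    Complex.I_im, Complex.mul_re]
  field_simp
  ring

theorem weyl_im_le {X Y m x y r : ℝ} (hX : 0 < X) (hY : 0 < Y) (hr : 0 < r)
    (hm : m ^ 2 ≤ X * Y) (hr2 : r ^ 2 * (X * Y) = 1)
    (h : X - 2 * m * x + Y * (x * x + y * y) ≤ 9 * (y / r)) : y / r ≤ 11 * X := by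
  set q := √(x * x + y * y) with hq
  have hq2 : q ^ 2 = x * x + y * y := Real.sq_sqrt (by nlinarith [sq_nonneg x, sq_nonneg y])
  have hq0 : 0 ≤ q := Real.sqrt_nonneg _
  have hyq : y ≤ q := Real.le_sqrt_of_sq_le (by nlinarith [sq_nonneg x])
  have hmr : (m * r) ^ 2 ≤ 1 := by nlinarith [sq_nonneg r]
  have hmx : m * x ≤ q / r := by
    rw [le_div_iff₀ hr]
    refine Real.le_sqrt_of_sq_le ?_
    nlinarith [sq_nonneg y, mul_le_mul_of_nonneg_right hmr (sq_nonneg x)]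
  have hyr : y / r ≤ q / r := by gcongr
  have h1 : Y * q ^ 2 ≤ 11 * (q / r) := by rw [hq2]; linarith
  rcases hq0.eq_or_lt with h0 | h0
  · rw [← h0, zero_div] at hyr
    linarith
  · have h2 : Y * q ≤ 11 / r := by
      have : (Y * q) * q ≤ (11 / r) * q := by
        calc _ = Y * q ^ 2 := by ring
          _ ≤ _ := h1
          _ = _ := by ring
      exact le_of_mul_le_mul_right this h0
    have h3 : Y * (q / r) ≤ Y * (11 * X) := by
      calc Y * (q / r) = (Y * q) / r := by ring
        _ ≤ (11 / r) / r := by gcongr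
        _ = 11 / r ^ 2 := by ring
        _ = Y * (11 * X) := by
          rw [div_eq_iff (by positivity)]
          linear_combination (-11) * hr2
    exact hyr.trans (le_of_mul_le_mul_left h3 hY)

/-- Two-sided bound for the Poisson integral of the spectral measure. -/
theorem IsSpectralMeasure.poissonKernelIntegral_bounds (hH : IsHamiltonian a b H)
    (hd : DiagNonVanishing a b H) (hμ : IsSpectralMeasure a b H μ) {T : ℝ} (haT : a < T)
    (hT : (T : EReal) < b) :
    ENNReal.ofReal (m1 a H T - m3 a H T ^ 2 / m2 a H T) ≤
        9 * poissonKernelIntegral μ (1 / √(m1 a H T * m2 a H T)) ∧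
      poissonKernelIntegral μ (1 / √(m1 a H T * m2 a H T)) ≤ 11 * ENNReal.ofReal (m1 a H T) := by
  have hfin := hμ.choose_spec.2.1
  obtain ⟨qH, hq, β, hβ, him⟩ := hμ.exists_weyl
  have hest : ∀ T : ℝ, a < T → (T : EReal) < b → 0 < 1 / √(m1 a H T * m2 a H T) ∧
      m1 a H T - m3 a H T ^ 2 / m2 a H T ≤
        9 * (β + ∫ x : ℝ, 1 / (x ^ 2 + (1 / √(m1 a H T * m2 a H T)) ^ 2) ∂μ) ∧
      β + ∫ x : ℝ, 1 / (x ^ 2 + (1 / √(m1 a H T * m2 a H T)) ^ 2) ∂μ ≤ 11 * m1 a H T := by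
    intro T haT hT
    have hX := hH.m1_pos hd haT hT
    have hY := hH.m2_pos hd haT hT
    have hs : 0 < √(m1 a H T * m2 a H T) := Real.sqrt_pos.2 (mul_pos hX hY)
    have hr : 0 < 1 / √(m1 a H T * m2 a H T) := by positivity
    have hr2 : (1 / √(m1 a H T * m2 a H T)) ^ 2 * (m1 a H T * m2 a H T) = 1 := by
      rw [div_pow, Real.sq_sqrt (mul_pos hX hY).le]
      field_simp
    have h := hq.estimate hH haT.le hT hr hr2
    rw [Complex.normSq_apply] at h
    rw [← him _ hr]
    refine ⟨hr, le_trans ?_ h, weyl_im_le hX hY hr (hH.m3_sq_le haT.le hT) hr2 h⟩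
    set x := (qH (↑(1 / √(m1 a H T * m2 a H T)) * Complex.I)).re
    set y := (qH (↑(1 / √(m1 a H T * m2 a H T)) * Complex.I)).im
    have h1 : m2 a H T * (m3 a H T ^ 2 / m2 a H T) = m3 a H T ^ 2 := by field_simp
    have h2 : 0 ≤ m2 a H T * (m3 a H T ^ 2 / m2 a H T - 2 * m3 a H T * x + m2 a H T * (x * x)) := by
      nlinarith [sq_nonneg (m2 a H T * x - m3 a H T)]
    have h3 := nonneg_of_mul_nonneg_right h2 hY
    nlinarith [mul_nonneg hY.le (mul_self_nonneg y)]
  have hpos : ∀ r : ℝ, 0 ≤ ∫ x : ℝ, 1 / (x ^ 2 + r ^ 2) ∂μ := fun r =>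
    integral_nonneg fun x => by positivity
  have hβ0 : β = 0 := by
    refine le_antisymm ?_ hβ
    have hlim : Tendsto (fun t => 11 * m1 a H t) (𝓝[>] a) (𝓝 (11 * 0)) :=
      (hH.tendsto_integral_entry 0 0).const_mul 11
    rw [mul_zero] at hlim
    refine ge_of_tendsto hlim ?_
    filter_upwards [Ioc_mem_nhdsGT haT] with t ht
    have := (hest t ht.1 (lt_of_le_of_lt (EReal.coe_le_coe_iff.2 ht.2) hT)).2.2
    linarith [hpos (1 / √(m1 a H t * m2 a H t))]
  obtain ⟨hr, h1, h2⟩ := hest T haT hT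
  rw [hβ0, zero_add] at h1 h2
  have hP : poissonKernelIntegral μ (1 / √(m1 a H T * m2 a H T)) =
      ENNReal.ofReal (∫ x : ℝ, 1 / (x ^ 2 + (1 / √(m1 a H T * m2 a H T)) ^ 2) ∂μ) :=
    (ofReal_integral_eq_lintegral_ofReal (integrable_inv_sq_add_sq hfin hr)
      (Eventually.of_forall fun x => by positivity)).symm
  rw [hP]
  refine ⟨?_, ?_⟩
  · rw [show (9 : ℝ≥0∞) = ENNReal.ofReal 9 by simp, ← ENNReal.ofReal_mul (by norm_num)]
    exact ENNReal.ofReal_le_ofReal h1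
  · rw [show (11 : ℝ≥0∞) = ENNReal.ofReal 11 by simp, ← ENNReal.ofReal_mul (by norm_num)]
    exact ENNReal.ofReal_le_ofReal h2

end Herglotz

section AbsolutelyContinuousLIntegral

theorem uIoc_disjoint_comp_of_monotoneOn {p : ℝ → ℝ} {s : Set ℝ} (hp : MonotoneOn p s)
    {x₁ x₂ y₁ y₂ : ℝ} (hx₁ : x₁ ∈ s) (hx₂ : x₂ ∈ s) (hy₁ : y₁ ∈ s) (hy₂ : y₂ ∈ s)
    (h : Disjoint (uIoc x₁ x₂) (uIoc y₁ y₂)) :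
    Disjoint (uIoc (p x₁) (p x₂)) (uIoc (p y₁) (p y₂)) := by
  wlog hx : x₁ ≤ x₂ generalizing x₁ x₂
  · rw [uIoc_comm] at h ⊢
    exact this hx₂ hx₁ h (le_of_not_ge hx)
  wlog hy : y₁ ≤ y₂ generalizing y₁ y₂
  · rw [uIoc_comm y₁] at h
    rw [uIoc_comm (p y₁)]
    exact this hy₂ hy₁ h (le_of_not_ge hy)
  rw [uIoc_of_le hx, uIoc_of_le hy, Ioc_disjoint_Ioc] at h
  rw [uIoc_of_le (hp hx₁ hx₂ hx), uIoc_of_le (hp hy₁ hy₂ hy), Ioc_disjoint_Ioc]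
  rcases min_le_iff.1 h with h | h <;> rcases le_max_iff.1 h with h | h
  · rw [le_antisymm hx h]
    exact (min_le_left _ _).trans (le_max_left _ _)
  · exact (min_le_left _ _).trans ((hp hx₂ hy₁ h).trans (le_max_right _ _))
  · exact (min_le_right _ _).trans ((hp hy₂ hx₁ h).trans (le_max_left _ _))
  · rw [le_antisymm hy h]
    exact (min_le_right _ _).trans (le_max_right _ _)

theorem AbsolutelyContinuousOnInterval.comp_monotoneOn {f p : ℝ → ℝ} {a b : ℝ}
    (hf : AbsolutelyContinuousOnInterval f (p a) (p b)) (hp : AbsolutelyContinuousOnInterval p a b)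
    (hmono : MonotoneOn p (uIcc a b)) (hab : a ≤ b) :
    AbsolutelyContinuousOnInterval (fun x => f (p x)) a b := by
  rw [absolutelyContinuousOnInterval_iff] at hf hp ⊢
  intro ε hε
  obtain ⟨δ, hδ, h1⟩ := hf ε hε
  obtain ⟨η, hη, h2⟩ := hp δ hδ
  refine ⟨η, hη, fun E hE hlt => ?_⟩
  have hmap : ∀ x ∈ uIcc a b, p x ∈ uIcc (p a) (p b) := fun x hx => by
    rw [uIcc_of_le (hmono left_mem_uIcc right_mem_uIcc hab)]
    have hx' := hx
    rw [uIcc_of_le hab] at hx'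
    exact ⟨hmono left_mem_uIcc hx hx'.1, hmono hx right_mem_uIcc hx'.2⟩
  refine h1 (E.1, fun i => (p (E.2 i).1, p (E.2 i).2)) ⟨fun i hi => ?_, ?_⟩ (h2 E hE hlt)
  · exact ⟨hmap _ (hE.1 i hi).1, hmap _ (hE.1 i hi).2⟩
  · intro i hi j hj hij
    exact uIoc_disjoint_comp_of_monotoneOn hmono (hE.1 i hi).1 (hE.1 i hi).2 (hE.1 j hj).1
      (hE.1 j hj).2 (hE.2 hi hj hij)

theorem AbsolutelyContinuousOnInterval.lintegral_Ioo {F g : ℝ → ℝ} {s T : ℝ} (hsT : s ≤ T)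
    (hF : AbsolutelyContinuousOnInterval F s T)
    (hd : ∀ᵐ t, t ∈ Ioo s T → HasDerivAt F (g t) t ∧ 0 ≤ g t) :
    ∫⁻ t in Ioo s T, ENNReal.ofReal (g t) = ENNReal.ofReal (F T - F s) := by
  have hd' : ∀ᵐ t ∂volume.restrict (Ioo s T), HasDerivAt F (g t) t ∧ 0 ≤ g t :=
    (ae_restrict_iff' measurableSet_Ioo).2 hd
  have heq : deriv F =ᵐ[volume.restrict (Ioo s T)] g := by
    filter_upwards [hd'] with t ht using ht.1.deriv
  have hi := hF.intervalIntegrable_deriv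
  rw [intervalIntegrable_iff_integrableOn_Ioo_of_le hsT] at hi
  have hgi : IntegrableOn g (Ioo s T) := hi.congr_fun_ae heq
  rw [← hF.integral_deriv_eq_sub, intervalIntegral.integral_of_le hsT,
    ← integral_Ioc_eq_integral_Ioo.symm, integral_congr_ae heq]
  refine (ofReal_integral_eq_lintegral_ofReal hgi ?_).symm
  filter_upwards [hd'] with t ht using ht.2

theorem lintegral_Ioo_of_tendsto_zero {F g : ℝ → ℝ} {a T : ℝ} (haT : a < T)
    (hF : ∀ s ∈ Ioo a T, AbsolutelyContinuousOnInterval F s T)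
    (hd : ∀ᵐ t, t ∈ Ioo a T → HasDerivAt F (g t) t ∧ 0 ≤ g t)
    (h0 : Tendsto F (𝓝[>] a) (𝓝 0)) :
    ∫⁻ t in Ioo a T, ENNReal.ofReal (g t) = ENNReal.ofReal (F T) := by
  obtain ⟨s, hs1, hs2, hs3⟩ := exists_seq_strictAnti_tendsto' haT
  have hun : Ioo a T = ⋃ n, Ioo (s n) T := by
    ext t
    simp only [mem_iUnion, mem_Ioo]
    constructor
    · rintro ⟨h1, h2⟩
      obtain ⟨n, hn⟩ := ((tendsto_order.1 hs3).2 t h1).exists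
      exact ⟨n, hn, h2⟩
    · rintro ⟨n, h1, h2⟩
      exact ⟨(hs2 n).1.trans h1, h2⟩
  have hmono : Monotone fun n => Ioo (s n) T := fun m n hmn =>
    Ioo_subset_Ioo_left (hs1.antitone hmn)
  have h1 := tendsto_measure_iUnion_atTop
    (μ := volume.withDensity fun t => ENNReal.ofReal (g t)) hmono
  rw [← hun, withDensity_apply _ measurableSet_Ioo] at h1
  have h2 : ∀ n, (volume.withDensity fun t => ENNReal.ofReal (g t)) (Ioo (s n) T) =
      ENNReal.ofReal (F T - F (s n)) := by
    intro n
    rw [withDensity_apply _ measurableSet_Ioo]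
    refine (hF _ (hs2 n)).lintegral_Ioo (hs2 n).2.le ?_
    filter_upwards [hd] with t ht ht'
    exact ht ⟨(hs2 n).1.trans ht'.1, ht'.2⟩
  have h3 : Tendsto (fun n => F (s n)) atTop (𝓝 0) :=
    h0.comp (tendsto_nhdsWithin_iff.2 ⟨hs3, Eventually.of_forall fun n => (hs2 n).1⟩)
  have h4 : Tendsto (fun n => ENNReal.ofReal (F T - F (s n))) atTop
      (𝓝 (ENNReal.ofReal (F T - 0))) := ENNReal.tendsto_ofReal (h3.const_sub _)
  rw [sub_zero] at h4
  simp only [Function.comp_def, h2] at h1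
  exact tendsto_nhds_unique h1 h4

theorem AbsolutelyContinuousOnInterval.lintegral_Ioo_comp {G G' p p' : ℝ → ℝ} {s T : ℝ}
    (hsT : s ≤ T) (hp : AbsolutelyContinuousOnInterval p s T) (hmono : MonotoneOn p (uIcc s T))
    (hd : ∀ᵐ t, t ∈ Ioo s T → HasDerivAt p (p' t) t ∧ 0 ≤ p' t)
    (hG : ∀ x ∈ Icc (p s) (p T), HasDerivAt G (G' x) x) (hG' : ∀ x ∈ Icc (p s) (p T), 0 ≤ G' x) :
    ∫⁻ t in Ioo s T, ENNReal.ofReal (G' (p t) * p' t) = ENNReal.ofReal (G (p T) - G (p s)) := by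
  have hle : p s ≤ p T := hmono left_mem_uIcc right_mem_uIcc hsT
  have hu : uIcc (p s) (p T) = Icc (p s) (p T) := uIcc_of_le hle
  have hGc : ContinuousOn G (uIcc (p s) (p T)) := by
    rw [hu]; exact fun x hx => (hG x hx).continuousAt.continuousWithinAt
  have hGi : IntervalIntegrable G' volume (p s) (p T) := by
    refine intervalIntegral.intervalIntegrable_deriv_of_nonneg hGc ?_ ?_ <;>
    · rw [min_eq_left hle, max_eq_right hle]
      intro x hx
      first
      | exact hG x (Ioo_subset_Icc_self hx)
      | exact hG' x (Ioo_subset_Icc_self hx)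
  have hGac : AbsolutelyContinuousOnInterval G (p s) (p T) := by
    have h1 := hGi.absolutelyContinuousOnInterval_intervalIntegral (c := p s) left_mem_uIcc
    rw [absolutelyContinuousOnInterval_iff] at h1 ⊢
    intro ε hε
    obtain ⟨δ, hδ, h2⟩ := h1 ε hε
    refine ⟨δ, hδ, fun E hE hlt => lt_of_le_of_lt (le_of_eq ?_) (h2 E hE hlt)⟩
    have key : ∀ x ∈ uIcc (p s) (p T), ∫ y in (p s)..x, G' y = G x - G (p s) := fun x hx =>
      intervalIntegral.integral_eq_sub_of_hasDerivAt
        (fun y hy => hG y (hu ▸ uIcc_subset_uIcc left_mem_uIcc hx hy))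
        (hGi.mono_set (uIcc_subset_uIcc left_mem_uIcc hx))
    refine Finset.sum_congr rfl fun i hi => ?_
    rw [key _ (hE.1 i hi).1, key _ (hE.1 i hi).2, dist_sub_right]
  refine (hGac.comp_monotoneOn hp hmono hsT).lintegral_Ioo hsT ?_
  filter_upwards [hd] with t ht htm
  have hm : p t ∈ Icc (p s) (p T) := by
    have h : t ∈ uIcc s T := by rw [uIcc_of_le hsT]; exact Ioo_subset_Icc_self htm
    exact ⟨hmono left_mem_uIcc h htm.1.le, hmono h right_mem_uIcc htm.2.le⟩
  exact ⟨(hG _ hm).comp t (ht htm).1, mul_nonneg (hG' _ hm) (ht htm).2⟩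

end AbsolutelyContinuousLIntegral

section HamiltonianCalculus

variable {a : ℝ} {b : EReal} {H : ℝ → Matrix (Fin 2) (Fin 2) ℝ}

theorem IsHamiltonian.absolutelyContinuous_integral_entry (hH : IsHamiltonian a b H) {T : ℝ}
    (haT : a ≤ T) (hT : (T : EReal) < b) (i j : Fin 2) :
    AbsolutelyContinuousOnInterval (fun t => ∫ s in a..t, H s i j) a T :=
  (hH.locInt i j T haT hT).absolutelyContinuousOnInterval_intervalIntegral left_mem_uIcc

theorem IsHamiltonian.ae_hasDerivAt_integral_entry (hH : IsHamiltonian a b H) {T : ℝ}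
    (haT : a ≤ T) (hT : (T : EReal) < b) (i j : Fin 2) :
    ∀ᵐ t, t ∈ Icc a T → HasDerivAt (fun t => ∫ s in a..t, H s i j) (H t i j) t := by
  filter_upwards [(hH.locInt i j T haT hT).ae_hasDerivAt_integral] with t ht htm
  rw [uIcc_of_le haT] at ht
  exact ht htm a (left_mem_Icc.2 haT)

theorem IsHamiltonian.monotoneOn_integral_entry (hH : IsHamiltonian a b H) {T : ℝ}
    (haT : a ≤ T) (hT : (T : EReal) < b) {i : Fin 2}
    (h0 : ∀ᵐ s, s ∈ Icc a T → 0 ≤ H s i i) :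
    MonotoneOn (fun t => ∫ s in a..t, H s i i) (Icc a T) := by
  intro s hs t ht hst
  have hIntegr := (hH.locInt i i T haT hT).mono_set
    (by rw [uIcc_of_le ht.1, uIcc_of_le haT]; exact Icc_subset_Icc_right ht.2 :
      uIcc a t ⊆ uIcc a T)
  refine intervalIntegral.integral_mono_interval le_rfl hs.1 hst ?_ hIntegr
  rw [EventuallyLE, ae_restrict_iff' measurableSet_Ioc]
  filter_upwards [h0] with x hx hx' using hx ⟨hx'.1.le, hx'.2.trans ht.2⟩

theorem IsHamiltonian.monotoneOn_m1 (hH : IsHamiltonian a b H) {T : ℝ}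
    (haT : a ≤ T) (hT : (T : EReal) < b) : MonotoneOn (m1 a H) (Icc a T) :=
  hH.monotoneOn_integral_entry haT hT
    (by filter_upwards [hH.ae_entryPSD_Icc hT] with s hs hsm using (hs hsm).nonneg₀)

theorem IsHamiltonian.monotoneOn_m2 (hH : IsHamiltonian a b H) {T : ℝ}
    (haT : a ≤ T) (hT : (T : EReal) < b) : MonotoneOn (m2 a H) (Icc a T) :=
  hH.monotoneOn_integral_entry haT hT
    (by filter_upwards [hH.ae_entryPSD_Icc hT] with s hs hsm using (hs hsm).nonneg₁)

theorem m1_self : m1 a H a = 0 := intervalIntegral.integral_same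

theorem m2_self : m2 a H a = 0 := intervalIntegral.integral_same

theorem IsHamiltonian.m1_nonneg (hH : IsHamiltonian a b H) {T : ℝ}
    (haT : a ≤ T) (hT : (T : EReal) < b) : 0 ≤ m1 a H T :=
  m1_self.symm.le.trans
    (hH.monotoneOn_m1 haT hT (left_mem_Icc.2 haT) (right_mem_Icc.2 haT) haT)

theorem IsHamiltonian.m2_nonneg (hH : IsHamiltonian a b H) {T : ℝ}
    (haT : a ≤ T) (hT : (T : EReal) < b) : 0 ≤ m2 a H T :=
  m2_self.symm.le.trans
    (hH.monotoneOn_m2 haT hT (left_mem_Icc.2 haT) (right_mem_Icc.2 haT) haT)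

theorem coe_lt_of_mem_Icc {T t : ℝ} (hT : (T : EReal) < b) (ht : t ∈ Icc a T) :
    (t : EReal) < b := lt_of_le_of_lt (EReal.coe_le_coe_iff.2 ht.2) hT

theorem IsHamiltonian.monotoneOn_mul (hH : IsHamiltonian a b H) {T : ℝ}
    (haT : a ≤ T) (hT : (T : EReal) < b) :
    MonotoneOn (fun t => m1 a H t * m2 a H t) (Icc a T) := by
  intro s hs t ht hst
  exact mul_le_mul (hH.monotoneOn_m1 haT hT hs ht hst) (hH.monotoneOn_m2 haT hT hs ht hst)
    (hH.m2_nonneg hs.1 (coe_lt_of_mem_Icc hT hs)) (hH.m1_nonneg ht.1 (coe_lt_of_mem_Icc hT ht))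

theorem IsHamiltonian.absolutelyContinuous_mul (hH : IsHamiltonian a b H) {T : ℝ}
    (haT : a ≤ T) (hT : (T : EReal) < b) :
    AbsolutelyContinuousOnInterval (fun t => m1 a H t * m2 a H t) a T :=
  (hH.absolutelyContinuous_integral_entry haT hT 0 0).fun_mul
    (hH.absolutelyContinuous_integral_entry haT hT 1 1)

theorem IsHamiltonian.ae_hasDerivAt_mul (hH : IsHamiltonian a b H) {T : ℝ}
    (haT : a ≤ T) (hT : (T : EReal) < b) :
    ∀ᵐ t, t ∈ Icc a T → HasDerivAt (fun t => m1 a H t * m2 a H t)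
      (H t 0 0 * m2 a H t + m1 a H t * H t 1 1) t ∧
      0 ≤ H t 0 0 * m2 a H t + m1 a H t * H t 1 1 := by
  filter_upwards [hH.ae_hasDerivAt_integral_entry haT hT 0 0,
    hH.ae_hasDerivAt_integral_entry haT hT 1 1, hH.ae_entryPSD_Icc hT] with t h1 h2 h3 ht
  have hb := coe_lt_of_mem_Icc hT ht
  exact ⟨(h1 ht).mul (h2 ht), add_nonneg (mul_nonneg (h3 ht).nonneg₀ (hH.m2_nonneg ht.1 hb))
    (mul_nonneg (hH.m1_nonneg ht.1 hb) (h3 ht).nonneg₁)⟩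

theorem IsHamiltonian.continuousOn_mul (hH : IsHamiltonian a b H) {T : ℝ}
    (haT : a ≤ T) (hT : (T : EReal) < b) :
    ContinuousOn (fun t => m1 a H t * m2 a H t) (Icc a T) :=
  (hH.continuousOn_integral_entry haT hT 0 0).mul (hH.continuousOn_integral_entry haT hT 1 1)

theorem IsHamiltonian.lintegral_h1 (hH : IsHamiltonian a b H) {T : ℝ}
    (haT : a ≤ T) (hT : (T : EReal) < b) :
    ∫⁻ t in Ioo a T, ENNReal.ofReal (H t 0 0) = ENNReal.ofReal (m1 a H T) := by
  rw [(hH.absolutelyContinuous_integral_entry haT hT 0 0).lintegral_Ioo haT]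
  · simp [m1]
  · filter_upwards [hH.ae_hasDerivAt_integral_entry haT hT 0 0, hH.ae_entryPSD_Icc hT]
      with t h1 h2 ht
    exact ⟨h1 (Ioo_subset_Icc_self ht), (h2 (Ioo_subset_Icc_self ht)).nonneg₀⟩

theorem IsHamiltonian.aemeasurable_entry (hH : IsHamiltonian a b H) {T : ℝ}
    (haT : a ≤ T) (hT : (T : EReal) < b) (i j : Fin 2) :
    AEMeasurable (fun t => H t i j) (volume.restrict (Ioo a T)) := by
  have h := hH.locInt i j T haT hT
  rw [intervalIntegrable_iff_integrableOn_Ioo_of_le haT] at h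
  exact h.aestronglyMeasurable.aemeasurable

/-- The density `m₂⁻² (m₂, -m₃) H (m₂, -m₃)ᵀ` of `det M / m₂`. -/
def schurDensity (a : ℝ) (H : ℝ → Matrix (Fin 2) (Fin 2) ℝ) (t : ℝ) : ℝ :=
  (![m2 a H t, -(m3 a H t)] ⬝ᵥ (H t).mulVec ![m2 a H t, -(m3 a H t)]) / m2 a H t ^ 2

theorem schurDensity_eq {t : ℝ} (h : H t 1 0 = H t 0 1) (hm : m2 a H t ≠ 0) :
    schurDensity a H t = H t 0 0 - 2 * (m3 a H t / m2 a H t) * H t 0 1 +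
      (m3 a H t / m2 a H t) ^ 2 * H t 1 1 := by
  simp only [schurDensity, Matrix.mulVec, dotProduct, Fin.sum_univ_two, Matrix.cons_val_zero,
    Matrix.cons_val_one, h]
  field_simp
  ring

theorem Mmat_det_div {t : ℝ} (hm : m2 a H t ≠ 0) :
    (Mmat a H t).det / m2 a H t = m1 a H t - m3 a H t ^ 2 / m2 a H t := by
  rw [Mmat, Matrix.det_fin_two_of]
  field_simp

theorem IsHamiltonian.ae_schurDensity (hH : IsHamiltonian a b H) (hd : DiagNonVanishing a b H)
    {T : ℝ} (haT : a ≤ T) (hT : (T : EReal) < b) :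
    ∀ᵐ t, t ∈ Ioo a T → HasDerivAt (fun t => m1 a H t - m3 a H t ^ 2 / m2 a H t)
      (schurDensity a H t) t ∧ 0 ≤ schurDensity a H t := by
  filter_upwards [hH.ae_hasDerivAt_integral_entry haT hT 0 0,
    hH.ae_hasDerivAt_integral_entry haT hT 1 1, hH.ae_hasDerivAt_integral_entry haT hT 0 1,
    hH.ae_entryPSD_Icc hT] with t h1 h2 h3 h4 ht'
  have ht := Ioo_subset_Icc_self ht'
  have hm : m2 a H t ≠ 0 := (hH.m2_pos hd ht'.1 (coe_lt_of_mem_Icc hT ht)).ne'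
  rw [schurDensity_eq (h4 ht).symm hm]
  constructor
  · have hm1 : HasDerivAt (m1 a H) _ t := h1 ht
    have hm2 : HasDerivAt (m2 a H) _ t := h2 ht
    have hm3 : HasDerivAt (m3 a H) _ t := h3 ht
    refine (hm1.sub ((hm3.pow 2).div hm2 hm)).congr_deriv ?_
    simp only [Pi.pow_apply]
    field_simp
    ring
  · have := (h4 ht).form_nonneg 1 (-(m3 a H t / m2 a H t))
    linarith

theorem lipschitzOnWith_inv_Ici {c : ℝ} (hc : 0 < c) :
    ∃ K : NNReal, LipschitzOnWith K (fun x : ℝ => x⁻¹) (Ici c) := by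
  refine ⟨Real.toNNReal (1 / c ^ 2), LipschitzOnWith.of_dist_le_mul fun x hx y hy => ?_⟩
  have hx0 : 0 < x := hc.trans_le hx
  have hy0 : 0 < y := hc.trans_le hy
  rw [Real.dist_eq, Real.dist_eq, inv_sub_inv hx0.ne' hy0.ne', abs_div, abs_sub_comm,
    abs_of_pos (mul_pos hx0 hy0), Real.coe_toNNReal _ (by positivity), one_div, inv_mul_eq_div]
  have : c ^ 2 ≤ x * y := by
    rw [sq]
    exact mul_le_mul hx hy hc.le hx0.le
  gcongr

theorem IsHamiltonian.lintegral_schurDensity (hH : IsHamiltonian a b H)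
    (hd : DiagNonVanishing a b H) {T : ℝ} (haT : a < T) (hT : (T : EReal) < b) :
    ∫⁻ t in Ioo a T, ENNReal.ofReal (schurDensity a H t) =
      ENNReal.ofReal (m1 a H T - m3 a H T ^ 2 / m2 a H T) := by
  refine lintegral_Ioo_of_tendsto_zero (F := fun t => m1 a H t - m3 a H t ^ 2 / m2 a H t) haT
    (fun s hs => ?_) (hH.ae_schurDensity hd haT.le hT) ?_
  · have hsub : uIcc s T ⊆ uIcc a T := by
      rw [uIcc_of_le hs.2.le, uIcc_of_le haT.le]; exact Icc_subset_Icc_left hs.1.le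
    have hac : ∀ i j, AbsolutelyContinuousOnInterval (fun t => ∫ s in a..t, H s i j) s T :=
      fun i j => (hH.absolutelyContinuous_integral_entry haT.le hT i j).mono hsub
    obtain ⟨K, hK⟩ := lipschitzOnWith_inv_Ici
      (hH.m2_pos hd hs.1 (coe_lt_of_mem_Icc hT (Ioo_subset_Icc_self hs)))
    have hinv := (hac 1 1).lipschitzOnWith_comp hK fun t ht => by
      rw [uIcc_of_le hs.2.le] at ht
      exact hH.monotoneOn_m2 haT.le hT (Ioo_subset_Icc_self hs)
        ⟨hs.1.le.trans ht.1, ht.2⟩ ht.1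
    have h := (hac 0 0).fun_sub (((hac 0 1).fun_mul (hac 0 1)).fun_mul hinv)
    refine cast (congrArg (fun F => AbsolutelyContinuousOnInterval F s T) ?_) h
    ext t
    simp only [m1, m2, m3]
    ring
  · refine tendsto_of_tendsto_of_tendsto_of_le_of_le' tendsto_const_nhds
      (hH.tendsto_integral_entry 0 0) ?_ ?_ <;>
    · filter_upwards [Ioc_mem_nhdsGT haT] with t ht
      have hb := coe_lt_of_mem_Icc hT (Ioc_subset_Icc_self ht)
      have hpos := hH.m2_pos hd ht.1 hb
      first
      | exact sub_nonneg.2 ((div_le_iff₀ hpos).2 (hH.m3_sq_le ht.1.le hb))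
      | exact sub_le_self _ (by positivity)

theorem IsHamiltonian.aemeasurable_schurDensity (hH : IsHamiltonian a b H) {T : ℝ}
    (haT : a ≤ T) (hT : (T : EReal) < b) :
    AEMeasurable (schurDensity a H) (volume.restrict (Ioo a T)) := by
  have hm : ∀ i j, AEMeasurable (fun t => ∫ s in a..t, H s i j) (volume.restrict (Ioo a T)) :=
    fun i j => ((hH.continuousOn_integral_entry haT hT i j).mono
      Ioo_subset_Icc_self).aemeasurable measurableSet_Ioo
  have he := hH.aemeasurable_entry haT hT
  have hm2 : AEMeasurable (m2 a H) (volume.restrict (Ioo a T)) := hm 1 1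
  have hm3 : AEMeasurable (m3 a H) (volume.restrict (Ioo a T)) := hm 0 1
  unfold schurDensity
  simp only [Matrix.mulVec, dotProduct, Fin.sum_univ_two, Matrix.cons_val_zero,
    Matrix.cons_val_one]
  exact ((hm2.mul (((he 0 0).mul hm2).add ((he 0 1).mul hm3.neg))).add
    (hm3.neg.mul (((he 1 0).mul hm2).add ((he 1 1).mul hm3.neg)))).div (hm2.pow_const 2)

end HamiltonianCalculus

section MeasureOfIntervals

theorem ContinuousOn.exists_level_of_monotoneOn {p : ℝ → ℝ} {a T q : ℝ} (haT : a ≤ T)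
    (hc : ContinuousOn p (Icc a T)) (hm : MonotoneOn p (Icc a T)) (h0 : p a < q) (h1 : q < p T) :
    ∃ τ ∈ Ioo a T, p τ = q ∧ ∀ t ∈ Icc a T, p t ≤ q ↔ t ≤ τ := by
  have hK : IsCompact (Icc a T ∩ p ⁻¹' Iic q) :=
    isCompact_Icc.of_isClosed_subset (hc.preimage_isClosed_of_isClosed isClosed_Icc isClosed_Iic)
      inter_subset_left
  obtain ⟨x, hx, hxq⟩ := intermediate_value_Icc haT hc ⟨h0.le, h1.le⟩
  obtain ⟨τ, ⟨hτ, hτq⟩, hmax⟩ := hK.exists_isGreatest ⟨x, hx, hxq.le⟩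
  have hxτ : x ≤ τ := hmax ⟨hx, hxq.le⟩
  have hpτ : p τ = q := le_antisymm hτq (hxq ▸ hm hx hτ hxτ)
  refine ⟨τ, ⟨hτ.1.lt_of_ne ?_, hτ.2.lt_of_ne ?_⟩, hpτ, fun t ht =>
    ⟨fun h => hmax ⟨ht, h⟩, fun h => hpτ ▸ hm ht hτ h⟩⟩
  · rintro rfl
    exact h0.ne hpτ
  · rintro rfl
    exact h1.ne' hpτ

theorem lintegral_mul_measure_Ioc {κ ν : Measure ℝ} [SFinite κ] [SFinite ν] {d : ℝ → ℝ≥0∞}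
    {r : ℝ → ℝ} (hd : AEMeasurable d κ) (hr : AEMeasurable r κ) (R : ℝ) :
    ∫⁻ t, d t * ν (Ioc R (r t)) ∂κ =
      ∫⁻ s in Ioi R, (∫⁻ t, {t | s ≤ r t}.indicator d t ∂κ) ∂ν := by
  rw [← lintegral_lintegral_swap]
  · refine lintegral_congr fun t => ?_
    have : ∀ s, {t | s ≤ r t}.indicator d t = (Iic (r t)).indicator (fun _ => d t) s :=
      fun s => rfl
    simp only [this]
    rw [lintegral_indicator measurableSet_Iic, setLIntegral_const,
      Measure.restrict_apply measurableSet_Iic, inter_comm, Ioi_inter_Iic]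
  · have h : NullMeasurableSet {x : ℝ × ℝ | x.2 ≤ r x.1} (κ.prod (ν.restrict (Ioi R))) :=
      nullMeasurableSet_le measurable_snd.aemeasurable hr.comp_fst
    exact hd.comp_fst.indicator₀ h

theorem exists_measure_Ioc_eq {f : ℝ → ℝ} (hfc : ContinuousOn f (Ioi 0))
    (hfm : MonotoneOn f (Ioi 0)) {R : ℝ} (hR : 0 < R) :
    ∃ ν : Measure ℝ, SFinite ν ∧
      ∀ x y, R ≤ x → R ≤ y → ν (Ioc x y) = ENNReal.ofReal (f y - f x) := by
  have hpos : ∀ x, max x R ∈ Ioi (0 : ℝ) := fun x => hR.trans_le (le_max_right x R)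
  let F : StieltjesFunction ℝ :=
    { toFun := fun x => f (max x R)
      mono' := fun x y hxy => hfm (hpos x) (hpos y) (max_le_max hxy le_rfl)
      right_continuous' := fun x => (hfc.comp_continuous (by fun_prop) hpos).continuousWithinAt }
  refine ⟨F.measure, inferInstance, fun x y hx hy => ?_⟩
  rw [F.measure_Ioc]
  change ENNReal.ofReal (f (max y R) - f (max x R)) = _
  rw [max_eq_left hx, max_eq_left hy]

end MeasureOfIntervals

section PoissonKernel

theorem lintegral_Ioi_two_div_cube {m : ℝ} (hm : 0 < m) :
    ∫⁻ s in Ioi m, ENNReal.ofReal (2 / s ^ 3) = ENNReal.ofReal (1 / m ^ 2) := by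
  have hd : ∀ x ∈ Ici m, HasDerivAt (fun s : ℝ => -(1 / s ^ 2)) (2 / x ^ 3) x := by
    intro x hx
    have hx0 : x ≠ 0 := (hm.trans_le hx).ne'
    have := (((hasDerivAt_id x).pow 2).inv (by simpa using hx0)).neg
    simp only [one_div]
    refine this.congr_deriv ?_
    simp only [Pi.pow_apply, id]
    field_simp
    norm_num [mul_comm]
  have hpos : ∀ x ∈ Ioi m, 0 ≤ 2 / x ^ 3 := fun x hx => by
    have : 0 < x := hm.trans hx
    positivity
  have hlim : Tendsto (fun s : ℝ => -(1 / s ^ 2)) atTop (𝓝 0) := by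
    simpa using (tendsto_pow_neg_atTop (𝕜 := ℝ) two_ne_zero).neg
  rw [← ofReal_integral_eq_lintegral_ofReal (integrableOn_Ioi_deriv_of_nonneg' hd hpos hlim)
    (by filter_upwards [ae_restrict_mem measurableSet_Ioi] with x hx using hpos x hx),
    integral_Ioi_of_hasDerivAt_of_nonneg' hd hpos hlim]
  simp

variable {μ : Measure ℝ}

theorem measure_Ioo_neg_lt_top
    (hμ : ∫⁻ t, ENNReal.ofReal (1 / (1 + t ^ 2)) ∂μ < ⊤) (s : ℝ) : μ (Ioo (-s) s) < ⊤ := by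
  have h : ENNReal.ofReal (1 / (1 + s ^ 2)) * μ (Ioo (-s) s) ≤
      ∫⁻ t, ENNReal.ofReal (1 / (1 + t ^ 2)) ∂μ := by
    rw [← setLIntegral_const]
    refine (setLIntegral_mono' measurableSet_Ioo fun t ht => ENNReal.ofReal_le_ofReal ?_).trans
      (setLIntegral_le_lintegral _ _)
    have : t ^ 2 ≤ s ^ 2 := sq_le_sq.2 ((abs_lt.2 ht).le.trans (le_abs_self s))
    gcongr
  have h0 : ENNReal.ofReal (1 / (1 + s ^ 2)) ≠ 0 := by
    rw [Ne, ENNReal.ofReal_eq_zero, not_le]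
    positivity
  exact ENNReal.lt_top_of_mul_ne_top_right (h.trans_lt hμ).ne h0

theorem isLocallyFiniteMeasure_of_lintegral
    (hμ : ∫⁻ t, ENNReal.ofReal (1 / (1 + t ^ 2)) ∂μ < ⊤) : IsLocallyFiniteMeasure μ :=
  ⟨fun x => ⟨Ioo (-(|x| + 1)) (|x| + 1), isOpen_Ioo.mem_nhds
    (abs_lt.1 (lt_add_one |x|)), measure_Ioo_neg_lt_top hμ _⟩⟩

theorem measurable_muSym : Measurable (muSym μ) :=
  Monotone.measurable fun _ _ h => measure_mono (Ioo_subset_Ioo (neg_le_neg h) h)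

theorem lintegral_muSym_two_div_cube [SFinite μ] {r : ℝ} (hr : 0 < r) :
    ∫⁻ s in Ioi r, muSym μ s * ENNReal.ofReal (2 / s ^ 3) =
      ∫⁻ x, ENNReal.ofReal (1 / max |x| r ^ 2) ∂μ := by
  have hS : MeasurableSet {q : ℝ × ℝ | |q.2| < q.1} :=
    measurableSet_lt (by fun_prop) (by fun_prop)
  calc ∫⁻ s in Ioi r, muSym μ s * ENNReal.ofReal (2 / s ^ 3)
      = ∫⁻ s in Ioi r, ∫⁻ x, {q : ℝ × ℝ | |q.2| < q.1}.indicator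
          (fun q => ENNReal.ofReal (2 / q.1 ^ 3)) (s, x) ∂μ := by
        refine lintegral_congr fun s => ?_
        have : ∀ x, {q : ℝ × ℝ | |q.2| < q.1}.indicator
            (fun q => ENNReal.ofReal (2 / q.1 ^ 3)) (s, x) =
            (Ioo (-s) s).indicator (fun _ => ENNReal.ofReal (2 / s ^ 3)) x := fun x => by
          simp only [indicator, mem_ofPred_eq, mem_Ioo, abs_lt]
        simp only [this]
        rw [lintegral_indicator measurableSet_Ioo, setLIntegral_const, mul_comm]
        rfl
    _ = ∫⁻ x, (∫⁻ s in Ioi r, {q : ℝ × ℝ | |q.2| < q.1}.indicator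
          (fun q => ENNReal.ofReal (2 / q.1 ^ 3)) (s, x)) ∂μ :=
        lintegral_lintegral_swap (((by fun_prop : Measurable fun q : ℝ × ℝ =>
          ENNReal.ofReal (2 / q.1 ^ 3)).indicator hS).aemeasurable)
    _ = ∫⁻ x, ENNReal.ofReal (1 / max |x| r ^ 2) ∂μ := by
        refine lintegral_congr fun x => ?_
        have : ∀ s, {q : ℝ × ℝ | |q.2| < q.1}.indicator
            (fun q => ENNReal.ofReal (2 / q.1 ^ 3)) (s, x) =
            (Ioi |x|).indicator (fun s => ENNReal.ofReal (2 / s ^ 3)) s := fun s => by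
          simp only [indicator, mem_ofPred_eq, mem_Ioi]
        simp only [this]
        rw [setLIntegral_indicator measurableSet_Ioi, Ioi_inter_Ioi,
          lintegral_Ioi_two_div_cube (hr.trans_le (le_max_right _ _))]

theorem poissonKernelIntegral_le_lintegral_muSym [SFinite μ] {r : ℝ} (hr : 0 < r) :
    poissonKernelIntegral μ r ≤ ∫⁻ s in Ioi r, muSym μ s * ENNReal.ofReal (2 / s ^ 3) := by
  rw [lintegral_muSym_two_div_cube hr]
  refine lintegral_mono fun x => ENNReal.ofReal_le_ofReal ?_
  have h : max |x| r ^ 2 ≤ x ^ 2 + r ^ 2 := by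
    rcases max_choice |x| r with h | h <;> rw [h] <;> nlinarith [sq_abs x, sq_nonneg x, sq_nonneg r]
  have : 0 < max |x| r := hr.trans_le (le_max_right _ _)
  gcongr

theorem lintegral_muSym_le_poissonKernelIntegral [SFinite μ] {r : ℝ} (hr : 0 < r) :
    ∫⁻ s in Ioi r, muSym μ s * ENNReal.ofReal (2 / s ^ 3) ≤ 2 * poissonKernelIntegral μ r := by
  rw [lintegral_muSym_two_div_cube hr, poissonKernelIntegral,
    ← lintegral_const_mul _ (by fun_prop)]
  refine lintegral_mono fun x => ?_
  rw [show (2 : ℝ≥0∞) = ENNReal.ofReal 2 by simp, ← ENNReal.ofReal_mul zero_le_two]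
  refine ENNReal.ofReal_le_ofReal ?_
  have h1 : x ^ 2 ≤ max |x| r ^ 2 := by
    rw [← sq_abs x]; gcongr; exact le_max_left _ _
  have h2 : r ^ 2 ≤ max |x| r ^ 2 := by gcongr; exact le_max_right _ _
  rw [mul_one_div, div_le_div_iff₀ (by positivity) (by positivity)]
  linarith

theorem poissonKernelIntegral_lt_top
    (hμ : ∫⁻ t, ENNReal.ofReal (1 / (1 + t ^ 2)) ∂μ < ⊤) {r : ℝ} (hr : 0 < r) :
    poissonKernelIntegral μ r < ⊤ := by
  rw [poissonKernelIntegral, ← ofReal_integral_eq_lintegral_ofReal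
    (integrable_inv_sq_add_sq hμ hr) (ae_of_all _ fun x => by positivity)]
  exact ENNReal.ofReal_lt_top

theorem lintegral_Ioi_muSym_lt_top_of_lintegral_Ioi {f : ℝ → ℝ} (hfm : MonotoneOn f (Ioi 0))
    (hμ : ∫⁻ t, ENNReal.ofReal (1 / (1 + t ^ 2)) ∂μ < ⊤) {A B : ℝ} (hA : 0 < A)
    (h : ∫⁻ r in Ioi B, muSym μ r * ENNReal.ofReal (f r / r ^ 3) < ⊤) :
    ∫⁻ r in Ioi A, muSym μ r * ENNReal.ofReal (f r / r ^ 3) < ⊤ := by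
  refine (lintegral_mono_set (fun r hr => ?_ : Ioi A ⊆ Ioc A B ∪ Ioi B)).trans_lt
    ((lintegral_union_le _ _ _).trans_lt (ENNReal.add_lt_top.2 ⟨?_, h⟩))
  · exact (le_or_gt r B).imp (fun h => ⟨hr, h⟩) id
  · refine (setLIntegral_mono' (g := fun _ => muSym μ B * (ENNReal.ofReal |f B| *
      ENNReal.ofReal (1 / A ^ 3))) measurableSet_Ioc fun r hr => ?_).trans_lt ?_
    · refine mul_le_mul' (measure_mono (Ioo_subset_Ioo (neg_le_neg hr.2) hr.2)) ?_
      rw [← ENNReal.ofReal_mul (abs_nonneg _), mul_one_div]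
      refine ENNReal.ofReal_le_ofReal ?_
      have h0 : 0 < r := hA.trans hr.1
      have h1 : f r ≤ |f B| := (hfm h0 (h0.trans_le hr.2) hr.2).trans (le_abs_self _)
      calc f r / r ^ 3 ≤ |f B| / r ^ 3 := by gcongr
        _ ≤ |f B| / A ^ 3 := by gcongr; exact hr.1.le
    · rw [setLIntegral_const, Real.volume_Ioc]
      exact ENNReal.mul_lt_top (ENNReal.mul_lt_top (measure_Ioo_neg_lt_top hμ B)
        (ENNReal.mul_lt_top ENNReal.ofReal_lt_top ENNReal.ofReal_lt_top)) ENNReal.ofReal_lt_top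

theorem lintegral_poissonKernelIntegral_lt_top_iff {f : ℝ → ℝ} (hfmeas : Measurable f)
    (hfm : MonotoneOn f (Ioi 0)) (hfpos : ∀ r, 0 < r → 0 < f r)
    (hμ : ∫⁻ t, ENNReal.ofReal (1 / (1 + t ^ 2)) ∂μ < ⊤) {R : ℝ} (hR : 0 < R) {ν : Measure ℝ}
    [SFinite ν] (hν : ∀ x y, R ≤ x → R ≤ y → ν (Ioc x y) = ENNReal.ofReal (f y - f x)) :
    ∫⁻ s in Ioi R, poissonKernelIntegral μ s ∂ν < ⊤ ↔
      ∫⁻ r in Ioi (1 : ℝ), muSym μ r * ENNReal.ofReal (f r / r ^ 3) < ⊤ := by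
  have := isLocallyFiniteMeasure_of_lintegral hμ
  set d : ℝ → ℝ≥0∞ := fun s => muSym μ s * ENNReal.ofReal (2 / s ^ 3) with hd_def
  have hd : Measurable d := measurable_muSym.mul (by fun_prop)
  have hswap : ∫⁻ t in Ioi R, d t * ENNReal.ofReal (f t - f R) =
      ∫⁻ s in Ioi R, (∫⁻ t in Ioi s, d t) ∂ν := by
    have h := lintegral_mul_measure_Ioc (κ := volume.restrict (Ioi R)) (ν := ν)
      (r := fun t => t) hd.aemeasurable aemeasurable_id' R
    rw [setLIntegral_congr_fun (g := fun t => d t * ENNReal.ofReal (f t - f R))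
      measurableSet_Ioi fun t (ht : R < t) => congrArg (d t * ·) (hν R t le_rfl ht.le)] at h
    rw [h]
    refine setLIntegral_congr_fun measurableSet_Ioi fun s (hs : R < s) => ?_
    change ∫⁻ t in Ioi R, (Ici s).indicator d t = _
    rw [setLIntegral_indicator measurableSet_Ici,
      inter_eq_left.2 (Ici_subset_Ioi.2 hs)]
    exact setLIntegral_congr Ioi_ae_eq_Ici.symm
  have hiff : ∫⁻ s in Ioi R, poissonKernelIntegral μ s ∂ν < ⊤ ↔
      ∫⁻ t in Ioi R, d t * ENNReal.ofReal (f t - f R) < ⊤ := by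
    rw [hswap]
    constructor <;> intro h
    · refine (setLIntegral_mono' measurableSet_Ioi fun s hs =>
        lintegral_muSym_le_poissonKernelIntegral (hR.trans hs)).trans_lt ?_
      rw [lintegral_const_mul' _ _ ENNReal.ofNat_ne_top]
      exact ENNReal.mul_lt_top ENNReal.ofNat_lt_top h
    · exact (setLIntegral_mono' measurableSet_Ioi fun s hs =>
        poissonKernelIntegral_le_lintegral_muSym (hR.trans hs)).trans_lt h
  have hdf : ∀ t ∈ Ioi R, 2 * (muSym μ t * ENNReal.ofReal (f t / t ^ 3)) =
      d t * ENNReal.ofReal (f t) := by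
    intro t ht
    have h0 : 0 < t := hR.trans ht
    rw [hd_def, mul_assoc, ← ENNReal.ofReal_mul (by positivity), mul_left_comm,
      show (2 : ℝ≥0∞) = ENNReal.ofReal 2 by simp, ← ENNReal.ofReal_mul zero_le_two]
    congr 2
    ring
  have hdR : ∫⁻ t in Ioi R, d t * ENNReal.ofReal (f R) < ⊤ := by
    rw [lintegral_mul_const' _ _ ENNReal.ofReal_ne_top]
    exact ENNReal.mul_lt_top ((lintegral_muSym_le_poissonKernelIntegral hR).trans_lt
      (ENNReal.mul_lt_top ENNReal.ofNat_lt_top (poissonKernelIntegral_lt_top hμ hR)))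
      ENNReal.ofReal_lt_top
  have htwo : ∫⁻ t in Ioi R, d t * ENNReal.ofReal (f t) =
      2 * ∫⁻ r in Ioi R, muSym μ r * ENNReal.ofReal (f r / r ^ 3) := by
    rw [← lintegral_const_mul' _ _ ENNReal.ofNat_ne_top]
    exact (setLIntegral_congr_fun measurableSet_Ioi hdf).symm
  rw [hiff]
  constructor <;> intro h
  · refine lintegral_Ioi_muSym_lt_top_of_lintegral_Ioi hfm hμ one_pos (B := R) ?_
    have h2 : ∫⁻ t in Ioi R, d t * ENNReal.ofReal (f t) < ⊤ := by
      refine lt_of_le_of_lt ?_ (ENNReal.add_lt_top.2 ⟨h, hdR⟩)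
      have hm : Measurable fun t => d t * ENNReal.ofReal (f t - f R) :=
        hd.mul (hfmeas.sub_const _).ennreal_ofReal
      rw [← lintegral_add_left hm]
      refine lintegral_mono fun t => ?_
      rw [← mul_add]
      gcongr
      simpa using ENNReal.ofReal_add_le (p := f t - f R) (q := f R)
    rw [htwo] at h2
    exact ENNReal.lt_top_of_mul_ne_top_right h2.ne two_ne_zero
  · refine lt_of_le_of_lt (lintegral_mono fun t => ?_) (htwo.trans_lt (ENNReal.mul_lt_top
      ENNReal.ofNat_lt_top (lintegral_Ioi_muSym_lt_top_of_lintegral_Ioi hfm hμ hR h)))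
    gcongr
    linarith [hfpos R hR]

end PoissonKernel

section MonotoneReparametrization

variable {p : ℝ → ℝ} {a T : ℝ} {f : ℝ → ℝ}

theorem one_div_sqrt_le_one_div_sqrt (hm : MonotoneOn p (Icc a T))
    (hpos : ∀ t ∈ Ioc a T, 0 < p t) {s t : ℝ} (hs : a < s) (hst : s ≤ t) (ht : t ≤ T) :
    1 / √(p t) ≤ 1 / √(p s) :=
  one_div_le_one_div_of_le (Real.sqrt_pos.2 (hpos s ⟨hs, hst.trans ht⟩))
    (Real.sqrt_le_sqrt (hm ⟨hs.le, hst.trans ht⟩ ⟨(hs.trans_le hst).le, ht⟩ hst))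

theorem exists_lintegral_indicator_eq_lintegral_Ioo (haT : a < T) (hc : ContinuousOn p (Icc a T))
    (hm : MonotoneOn p (Icc a T)) (h0 : p a = 0) (hpos : ∀ t ∈ Ioc a T, 0 < p t) (d : ℝ → ℝ≥0∞)
    {s : ℝ} (hs : 1 / √(p T) < s) :
    ∃ τ ∈ Ioo a T, 1 / √(p τ) = s ∧
      ∫⁻ t in Ioo a T, {t | s ≤ 1 / √(p t)}.indicator d t = ∫⁻ t in Ioo a τ, d t := by
  have hT : 0 < √(p T) := Real.sqrt_pos.2 (hpos T (right_mem_Ioc.2 haT))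
  have hs0 : 0 < s := (one_div_pos.2 hT).trans hs
  have hsq : √(1 / s ^ 2) = 1 / s := by
    rw [Real.sqrt_div zero_le_one, Real.sqrt_one, Real.sqrt_sq hs0.le]
  obtain ⟨τ, hτ, hpτ, hlev⟩ := hc.exists_level_of_monotoneOn (q := 1 / s ^ 2) haT.le hm
    (by rw [h0]; positivity) (by
      rw [← Real.sqrt_lt_sqrt_iff (by positivity), hsq, one_div_lt hs0 hT]
      exact hs)
  have hlev' : ∀ t ∈ Ioo a T, s ≤ 1 / √(p t) ↔ t ≤ τ := fun t ht => by
    rw [← hlev t (Ioo_subset_Icc_self ht), ← Real.sqrt_le_sqrt_iff (x := p t) (by positivity),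
      hsq, le_one_div hs0 (Real.sqrt_pos.2 (hpos t (Ioo_subset_Ioc_self ht)))]
  refine ⟨τ, hτ, by rw [hpτ, hsq, one_div_one_div], ?_⟩
  calc ∫⁻ t in Ioo a T, {t | s ≤ 1 / √(p t)}.indicator d t
      = ∫⁻ t in Ioo a T, (Iic τ).indicator d t := by
        refine setLIntegral_congr_fun measurableSet_Ioo fun t ht => ?_
        simp only [indicator, mem_ofPred_eq, mem_Iic, hlev' t ht]
    _ = ∫⁻ t in Ioc a τ, d t := by
        rw [setLIntegral_indicator measurableSet_Iic]
        congr 2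
        ext t
        exact ⟨fun h => ⟨h.2.1, h.1⟩, fun h => ⟨h.2, h.1, h.2.trans_lt hτ.2⟩⟩
    _ = ∫⁻ t in Ioo a τ, d t := setLIntegral_congr Ioo_ae_eq_Ioc.symm

theorem aemeasurable_one_div_sqrt (hc : ContinuousOn p (Icc a T)) :
    AEMeasurable (fun t => 1 / √(p t)) (volume.restrict (Ioo a T)) :=
  aemeasurable_const.div
    ((hc.mono Ioo_subset_Icc_self).aemeasurable measurableSet_Ioo).sqrt

theorem lintegral_mul_sub_eq_lintegral_indicator (hc : ContinuousOn p (Icc a T))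
    (hm : MonotoneOn p (Icc a T)) (hpos : ∀ t ∈ Ioc a T, 0 < p t) {ν : Measure ℝ} [SFinite ν]
    (hν : ∀ x y, 1 / √(p T) ≤ x → 1 / √(p T) ≤ y → ν (Ioc x y) = ENNReal.ofReal (f y - f x))
    {d : ℝ → ℝ≥0∞} (hd : AEMeasurable d (volume.restrict (Ioo a T))) :
    ∫⁻ t in Ioo a T, d t * ENNReal.ofReal (f (1 / √(p t)) - f (1 / √(p T))) =
      ∫⁻ s in Ioi (1 / √(p T)),
        (∫⁻ t in Ioo a T, {t | s ≤ 1 / √(p t)}.indicator d t) ∂ν := by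
  rw [← lintegral_mul_measure_Ioc hd (aemeasurable_one_div_sqrt hc)]
  refine setLIntegral_congr_fun measurableSet_Ioo fun t ht => ?_
  simp only [hν _ _ le_rfl (one_div_sqrt_le_one_div_sqrt hm hpos ht.1 ht.2.le le_rfl)]

theorem lintegral_ofReal_mul_lt_top_iff (haT : a < T)
    (hpos : ∀ t ∈ Ioc a T, 0 < p t) (hf : ∀ r, 0 < r → 0 < f r) {d : ℝ → ℝ}
    (hd : AEMeasurable d (volume.restrict (Ioo a T)))
    (hfin : ∫⁻ t in Ioo a T, ENNReal.ofReal (d t) < ⊤) :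
    ∫⁻ t in Ioo a T, ENNReal.ofReal (d t * f (1 / √(p t))) < ⊤ ↔
      ∫⁻ t in Ioo a T, ENNReal.ofReal (d t) *
        ENNReal.ofReal (f (1 / √(p t)) - f (1 / √(p T))) < ⊤ := by
  have hr : ∀ t ∈ Ioc a T, 0 < 1 / √(p t) := fun t ht =>
    one_div_pos.2 (Real.sqrt_pos.2 (hpos t ht))
  have hfT := hf _ (hr T (right_mem_Ioc.2 haT))
  have hmul : ∀ t ∈ Ioo a T, ENNReal.ofReal (d t * f (1 / √(p t))) =
      ENNReal.ofReal (d t) * ENNReal.ofReal (f (1 / √(p t))) := fun t ht =>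
    ENNReal.ofReal_mul' (hf _ (hr t (Ioo_subset_Ioc_self ht))).le
  rw [setLIntegral_congr_fun measurableSet_Ioo hmul]
  constructor <;> intro h
  · refine (lintegral_mono fun t => ?_).trans_lt h
    gcongr
    linarith
  · have hconst : ∫⁻ t in Ioo a T, ENNReal.ofReal (d t) * ENNReal.ofReal (f (1 / √(p T))) < ⊤ := by
      rw [lintegral_mul_const' _ _ ENNReal.ofReal_ne_top]
      exact ENNReal.mul_lt_top hfin ENNReal.ofReal_lt_top
    refine lt_of_le_of_lt ?_ (ENNReal.add_lt_top.2 ⟨h, hconst⟩)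
    rw [← lintegral_add_right' _ (hd.ennreal_ofReal.mul_const _)]
    refine lintegral_mono fun t => ?_
    rw [← mul_add]
    gcongr
    simpa using ENNReal.ofReal_add_le (p := f (1 / √(p t)) - f (1 / √(p T)))
      (q := f (1 / √(p T)))

theorem hasDerivAt_comp_one_div_sqrt {f' : ℝ → ℝ} (hf' : ∀ x, 0 < x → HasDerivAt f (f' x) x)
    {x : ℝ} (hx : 0 < x) :
    HasDerivAt (fun x => -2 * f (1 / √x)) (f' (1 / √x) / √x ^ 3) x := by
  have hs : 0 < √x := Real.sqrt_pos.2 hx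
  have h1 : HasDerivAt (fun x => 1 / √x) (-(1 / (2 * √x)) / √x ^ 2) x := by
    simp only [one_div]
    simpa only [one_div] using (Real.hasDerivAt_sqrt hx.ne').fun_inv hs.ne'
  refine (((hf' _ (one_div_pos.2 hs)).comp x h1).const_mul (-2)).congr_deriv ?_
  field_simp

theorem lintegral_Ioo_deriv_comp_one_div_sqrt {p' f' : ℝ → ℝ}
    (hp : AbsolutelyContinuousOnInterval p a T) (hm : MonotoneOn p (Icc a T))
    (hpos : ∀ t ∈ Ioc a T, 0 < p t)
    (hp' : ∀ᵐ t, t ∈ Ioo a T → HasDerivAt p (p' t) t ∧ 0 ≤ p' t)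
    (hf' : ∀ x, 0 < x → HasDerivAt f (f' x) x) (hf'0 : ∀ x, 0 < x → 0 ≤ f' x)
    {s : ℝ} (hs : s ∈ Ioo a T) :
    ∫⁻ t in Ioo s T, ENNReal.ofReal (f' (1 / √(p t)) * (p' t / √(p t) ^ 3)) =
      2 * ENNReal.ofReal (f (1 / √(p s)) - f (1 / √(p T))) := by
  have hsub : uIcc s T ⊆ uIcc a T := by
    rw [uIcc_of_le hs.2.le, uIcc_of_le (hs.1.trans hs.2).le]
    exact Icc_subset_Icc_left hs.1.le
  have hm' : MonotoneOn p (uIcc s T) := by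
    refine hm.mono (hsub.trans_eq ?_)
    rw [uIcc_of_le (hs.1.trans hs.2).le]
  have hps := hpos s (Ioo_subset_Ioc_self hs)
  have h := (hp.mono hsub).lintegral_Ioo_comp (G := fun x => -2 * f (1 / √x))
    (G' := fun x => f' (1 / √x) / √x ^ 3) (p' := p') hs.2.le hm'
    (by filter_upwards [hp'] with t ht hts using ht ⟨hs.1.trans hts.1, hts.2⟩)
    (fun x hx => hasDerivAt_comp_one_div_sqrt hf' (hps.trans_le hx.1))
    (fun x hx => by
      have hx0 := hps.trans_le hx.1
      have := hf'0 _ (one_div_pos.2 (Real.sqrt_pos.2 hx0))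
      positivity)
  rw [show (2 : ℝ≥0∞) = ENNReal.ofReal 2 by simp, ← ENNReal.ofReal_mul zero_le_two]
  refine (lintegral_congr fun t => ?_).trans (h.trans ?_) <;> congr 1 <;> ring

theorem lintegral_primitive_mul_deriv_comp {p' f' d D : ℝ → ℝ}
    (hp : AbsolutelyContinuousOnInterval p a T) (hc : ContinuousOn p (Icc a T))
    (hm : MonotoneOn p (Icc a T)) (hpos : ∀ t ∈ Ioc a T, 0 < p t)
    (hp' : ∀ᵐ t, t ∈ Ioo a T → HasDerivAt p (p' t) t ∧ 0 ≤ p' t)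
    (hp'm : AEMeasurable p' (volume.restrict (Ioo a T)))
    (hf' : ∀ x, 0 < x → HasDerivAt f (f' x) x) (hf'0 : ∀ x, 0 < x → 0 ≤ f' x)
    (hf'm : Measurable f') (hd : AEMeasurable d (volume.restrict (Ioo a T)))
    (hD : ∀ t ∈ Ioo a T, ENNReal.ofReal (D t) = ∫⁻ s in Ioo a t, ENNReal.ofReal (d s)) :
    ∫⁻ t in Ioo a T, ENNReal.ofReal (D t * f' (1 / √(p t)) * (p' t / √(p t) ^ 3)) =
      2 * ∫⁻ t in Ioo a T, ENNReal.ofReal (d t) *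
        ENNReal.ofReal (f (1 / √(p t)) - f (1 / √(p T))) := by
  set κ := volume.restrict (Ioo a T) with hκ
  set w : ℝ → ℝ≥0∞ := fun t => ENNReal.ofReal (f' (1 / √(p t)) * (p' t / √(p t) ^ 3)) with hw
  have hpm : AEMeasurable p κ := (hc.mono Ioo_subset_Icc_self).aemeasurable measurableSet_Ioo
  have hwm : AEMeasurable w κ :=
    ((hf'm.comp_aemeasurable (aemeasurable_one_div_sqrt hc)).mul
      (hp'm.div (hpm.sqrt.pow_const 3))).ennreal_ofReal
  have hS : MeasurableSet {q : ℝ × ℝ | q.2 < q.1} := measurableSet_lt measurable_snd measurable_fst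
  set K : ℝ → ℝ → ℝ≥0∞ := fun t s =>
    {q : ℝ × ℝ | q.2 < q.1}.indicator (fun q => w q.1 * ENNReal.ofReal (d q.2)) (t, s) with hK
  have hKm : AEMeasurable (Function.uncurry K) (κ.prod κ) :=
    (hwm.comp_fst.mul hd.ennreal_ofReal.comp_snd).indicator hS
  have hK1 : ∀ t ∈ Ioo a T, ∫⁻ s, K t s ∂κ = w t * ∫⁻ s in Ioo a t, ENNReal.ofReal (d s) := by
    intro t ht
    change ∫⁻ s, (Iio t).indicator (fun s => w t * ENNReal.ofReal (d s)) s ∂κ = _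
    rw [hκ, setLIntegral_indicator measurableSet_Iio, lintegral_const_mul' _ _
      ENNReal.ofReal_ne_top, inter_comm, Ioo_inter_Iio, min_eq_right ht.2.le]
  have hK2 : ∀ s ∈ Ioo a T, ∫⁻ t, K t s ∂κ =
      2 * (ENNReal.ofReal (d s) * ENNReal.ofReal (f (1 / √(p s)) - f (1 / √(p T)))) := by
    intro s hs
    change ∫⁻ t, (Ioi s).indicator (fun t => w t * ENNReal.ofReal (d s)) t ∂κ = _
    rw [hκ, setLIntegral_indicator measurableSet_Ioi, lintegral_mul_const' _ _
      ENNReal.ofReal_ne_top, inter_comm, Ioo_inter_Ioi, sup_eq_right.2 hs.1.le,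
      lintegral_Ioo_deriv_comp_one_div_sqrt hp hm hpos hp' hf' hf'0 hs]
    ring
  calc ∫⁻ t, ENNReal.ofReal (D t * f' (1 / √(p t)) * (p' t / √(p t) ^ 3)) ∂κ
      = ∫⁻ t, ∫⁻ s, K t s ∂κ ∂κ := by
        refine lintegral_congr_ae ((ae_restrict_iff' measurableSet_Ioo).2 ?_)
        filter_upwards [hp'] with t ht htm
        have hpt : 0 < √(p t) := Real.sqrt_pos.2 (hpos t (Ioo_subset_Ioc_self htm))
        have := hf'0 _ (one_div_pos.2 hpt)
        have := (ht htm).2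
        rw [hK1 t htm, ← hD t htm, mul_assoc, ENNReal.ofReal_mul' (by positivity), mul_comm]
    _ = ∫⁻ s, ∫⁻ t, K t s ∂κ ∂κ := lintegral_lintegral_swap hKm
    _ = _ := by
        rw [setLIntegral_congr_fun measurableSet_Ioo hK2,
          lintegral_const_mul' _ _ ENNReal.ofNat_ne_top]

end MonotoneReparametrization

section SpectralMeasure

variable {a : ℝ} {b : EReal} {H : ℝ → Matrix (Fin 2) (Fin 2) ℝ} {f : ℝ → ℝ} {μ : Measure ℝ}

theorem m1_mul_m2_self : m1 a H a * m2 a H a = 0 := by rw [m1_self, zero_mul]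

theorem IsHamiltonian.mul_pos (hH : IsHamiltonian a b H) (hd : DiagNonVanishing a b H) {T : ℝ}
    (hT : (T : EReal) < b) : ∀ t ∈ Ioc a T, 0 < m1 a H t * m2 a H t := fun _ ht =>
  have hb := coe_lt_of_mem_Icc hT (Ioc_subset_Icc_self ht)
  _root_.mul_pos (hH.m1_pos hd ht.1 hb) (hH.m2_pos hd ht.1 hb)

theorem IsSpectralMeasure.lintegral_lt_top_of_lintegral_h1 (hH : IsHamiltonian a b H)
    (hd : DiagNonVanishing a b H) (hμ : IsSpectralMeasure a b H μ) (hfmeas : Measurable f)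
    (hfpos : ∀ r, 0 < r → 0 < f r) (hfc : ContinuousOn f (Ioi 0)) (hfm : MonotoneOn f (Ioi 0))
    {T : ℝ} (haT : a < T) (hT : (T : EReal) < b)
    (h : ∫⁻ t in Ioo a T, ENNReal.ofReal (H t 0 0 * f (1 / √(m1 a H t * m2 a H t))) < ⊤) :
    ∫⁻ r in Ioi (1 : ℝ), muSym μ r * ENNReal.ofReal (f r / r ^ 3) < ⊤ := by
  have hpos := hH.mul_pos hd hT
  have hR : 0 < 1 / √(m1 a H T * m2 a H T) :=
    one_div_pos.2 (Real.sqrt_pos.2 (hpos T (right_mem_Ioc.2 haT)))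
  have hc := hH.continuousOn_mul haT.le hT
  have hm := hH.monotoneOn_mul haT.le hT
  have hdm := hH.aemeasurable_entry haT.le hT 0 0
  obtain ⟨ν, _, hν⟩ := exists_measure_Ioc_eq hfc hfm hR
  rw [lintegral_ofReal_mul_lt_top_iff haT hpos hfpos hdm
    ((hH.lintegral_h1 haT.le hT).trans_lt ENNReal.ofReal_lt_top),
    lintegral_mul_sub_eq_lintegral_indicator hc hm hpos hν hdm.ennreal_ofReal] at h
  rw [← lintegral_poissonKernelIntegral_lt_top_iff hfmeas hfm hfpos hμ.choose_spec.2.1 hR hν]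
  refine (setLIntegral_mono' measurableSet_Ioi fun s hs => ?_).trans_lt
    ((lintegral_const_mul' 11 _ ENNReal.ofNat_ne_top).trans_lt
      (ENNReal.mul_lt_top ENNReal.ofNat_lt_top h))
  obtain ⟨τ, hτ, rfl, hIntegr⟩ := exists_lintegral_indicator_eq_lintegral_Ioo haT hc hm
    m1_mul_m2_self hpos (fun t => ENNReal.ofReal (H t 0 0)) hs
  have hb := coe_lt_of_mem_Icc hT (Ioo_subset_Icc_self hτ)
  rw [hIntegr, hH.lintegral_h1 hτ.1.le hb]
  exact (hμ.poissonKernelIntegral_bounds hH hd hτ.1 hb).2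

theorem IsSpectralMeasure.lintegral_schurDensity_lt_top (hH : IsHamiltonian a b H)
    (hd : DiagNonVanishing a b H) (hμ : IsSpectralMeasure a b H μ) (hfmeas : Measurable f)
    (hfpos : ∀ r, 0 < r → 0 < f r) (hfc : ContinuousOn f (Ioi 0)) (hfm : MonotoneOn f (Ioi 0))
    {T : ℝ} (haT : a < T) (hT : (T : EReal) < b)
    (h : ∫⁻ r in Ioi (1 : ℝ), muSym μ r * ENNReal.ofReal (f r / r ^ 3) < ⊤) :
    ∫⁻ t in Ioo a T, ENNReal.ofReal
      (schurDensity a H t * f (1 / √(m1 a H t * m2 a H t))) < ⊤ := by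
  have hpos := hH.mul_pos hd hT
  have hR : 0 < 1 / √(m1 a H T * m2 a H T) :=
    one_div_pos.2 (Real.sqrt_pos.2 (hpos T (right_mem_Ioc.2 haT)))
  have hc := hH.continuousOn_mul haT.le hT
  have hm := hH.monotoneOn_mul haT.le hT
  have hdm := hH.aemeasurable_schurDensity haT.le hT
  obtain ⟨ν, _, hν⟩ := exists_measure_Ioc_eq hfc hfm hR
  rw [← lintegral_poissonKernelIntegral_lt_top_iff hfmeas hfm hfpos hμ.choose_spec.2.1 hR hν] at h
  rw [lintegral_ofReal_mul_lt_top_iff haT hpos hfpos hdm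
    ((hH.lintegral_schurDensity hd haT hT).trans_lt ENNReal.ofReal_lt_top),
    lintegral_mul_sub_eq_lintegral_indicator hc hm hpos hν hdm.ennreal_ofReal]
  refine (setLIntegral_mono' measurableSet_Ioi fun s hs => ?_).trans_lt
    ((lintegral_const_mul' 9 _ ENNReal.ofNat_ne_top).trans_lt
      (ENNReal.mul_lt_top ENNReal.ofNat_lt_top h))
  obtain ⟨τ, hτ, rfl, hIntegr⟩ := exists_lintegral_indicator_eq_lintegral_Ioo haT hc hm
    m1_mul_m2_self hpos (fun t => ENNReal.ofReal (schurDensity a H t)) hs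
  have hb := coe_lt_of_mem_Icc hT (Ioo_subset_Icc_self hτ)
  rw [hIntegr, hH.lintegral_schurDensity hd hτ.1 hb]
  exact (hμ.poissonKernelIntegral_bounds hH hd hτ.1 hb).1

theorem IsHamiltonian.lintegral_mul_comp_lt_top_iff (hH : IsHamiltonian a b H)
    (hdiag : DiagNonVanishing a b H) (hfpos : ∀ r, 0 < r → 0 < f r) {f' : ℝ → ℝ}
    (hf' : ∀ x, 0 < x → HasDerivAt f (f' x) x) (hf'0 : ∀ x, 0 < x → 0 ≤ f' x)
    (hf'm : Measurable f') {T : ℝ} (haT : a < T) (hT : (T : EReal) < b) {d D : ℝ → ℝ}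
    (hd : AEMeasurable d (volume.restrict (Ioo a T)))
    (hD : ∀ t ∈ Ioc a T, ∫⁻ s in Ioo a t, ENNReal.ofReal (d s) = ENNReal.ofReal (D t)) :
    ∫⁻ t in Ioo a T, ENNReal.ofReal (d t * f (1 / √(m1 a H t * m2 a H t))) < ⊤ ↔
      ∫⁻ t in Ioo a T, ENNReal.ofReal (D t * f' (1 / √(m1 a H t * m2 a H t)) *
        ((H t 0 0 * m2 a H t + m1 a H t * H t 1 1) / √(m1 a H t * m2 a H t) ^ 3)) < ⊤ := by
  have hpos := hH.mul_pos hdiag hT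
  have he := hH.aemeasurable_entry haT.le hT
  have hm : ∀ i j, AEMeasurable (fun t => ∫ s in a..t, H s i j) (volume.restrict (Ioo a T)) :=
    fun i j => ((hH.continuousOn_integral_entry haT.le hT i j).mono
      Ioo_subset_Icc_self).aemeasurable measurableSet_Ioo
  rw [lintegral_primitive_mul_deriv_comp (p := fun t => m1 a H t * m2 a H t) (d := d)
    (p' := fun t => H t 0 0 * m2 a H t + m1 a H t * H t 1 1)
    (hH.absolutelyContinuous_mul haT.le hT) (hH.continuousOn_mul haT.le hT)
    (hH.monotoneOn_mul haT.le hT) hpos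
    (by filter_upwards [hH.ae_hasDerivAt_mul haT.le hT] with t ht htm
        using ht (Ioo_subset_Icc_self htm))
    (((he 0 0).mul (hm 1 1)).add ((hm 0 0).mul (he 1 1))) hf' hf'0 hf'm hd
    (fun t ht => (hD t (Ioo_subset_Ioc_self ht)).symm),
    lintegral_ofReal_mul_lt_top_iff haT hpos hfpos hd
      ((hD T (right_mem_Ioc.2 haT)).trans_lt ENNReal.ofReal_lt_top)]
  exact ⟨fun h => ENNReal.mul_lt_top ENNReal.ofNat_lt_top h,
    fun h => ENNReal.lt_top_of_mul_ne_top_right h.ne two_ne_zero⟩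

end SpectralMeasure

/-- Proposition 4.7: integrability conditions for the spectral measure. -/
theorem stmt13 (a : ℝ) (b : EReal) (H : ℝ → Matrix (Fin 2) (Fin 2) ℝ)
    (hH : IsHamiltonian a b H) (hdiag : DiagNonVanishing a b H)
    (f : ℝ → ℝ) (ρ : ℝ) (hf : RegularlyVarying f ρ)
    (hfc : ContinuousOn f (Set.Ioi 0)) (hfm : MonotoneOn f (Set.Ioi 0))
    (μ : Measure ℝ) (hμ : IsSpectralMeasure a b H μ) :
    ((∃ a' : ℝ, a < a' ∧ (a' : EReal) < b ∧
        (∫⁻ t in Set.Ioo a a',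
          ENNReal.ofReal (H t 0 0 *
            f (1 / Real.sqrt (m1 a H t * m2 a H t)))) < ⊤) →
      (∫⁻ r in Set.Ioi (1:ℝ), muSym μ r * ENNReal.ofReal (f r / r ^ 3)) < ⊤) ∧
    ((∫⁻ r in Set.Ioi (1:ℝ), muSym μ r * ENNReal.ofReal (f r / r ^ 3)) < ⊤ →
      ∃ a' : ℝ, a < a' ∧ (a' : EReal) < b ∧
        (∫⁻ t in Set.Ioo a a',
          ENNReal.ofReal
            ((![m2 a H t, -(m3 a H t)] ⬝ᵥ (H t).mulVec ![m2 a H t, -(m3 a H t)]) /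
                m2 a H t ^ 2 *
              f (1 / Real.sqrt (m1 a H t * m2 a H t)))) < ⊤) ∧
    (∀ f' : ℝ → ℝ, (∀ x : ℝ, 0 < x → HasDerivAt f (f' x) x) →
      (∃ ρ' : ℝ, RegularlyVarying f' ρ') →
      ((∃ a' : ℝ, a < a' ∧ (a' : EReal) < b ∧
          (∫⁻ t in Set.Ioo a a',
            ENNReal.ofReal (H t 0 0 *
              f (1 / Real.sqrt (m1 a H t * m2 a H t)))) < ⊤) ↔
        ∃ a' : ℝ, a < a' ∧ (a' : EReal) < b ∧
          (∫⁻ t in Set.Ioo a a',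
            ENNReal.ofReal (m1 a H t *
              f' (1 / Real.sqrt (m1 a H t * m2 a H t)) *
              ((H t 0 0 * m2 a H t + m1 a H t * H t 1 1) /
                Real.sqrt (m1 a H t * m2 a H t) ^ 3))) < ⊤) ∧
      ((∃ a' : ℝ, a < a' ∧ (a' : EReal) < b ∧
          (∫⁻ t in Set.Ioo a a',
            ENNReal.ofReal
              ((![m2 a H t, -(m3 a H t)] ⬝ᵥ (H t).mulVec ![m2 a H t, -(m3 a H t)]) /
                  m2 a H t ^ 2 *
                f (1 / Real.sqrt (m1 a H t * m2 a H t)))) < ⊤) ↔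
        ∃ a' : ℝ, a < a' ∧ (a' : EReal) < b ∧
          (∫⁻ t in Set.Ioo a a',
            ENNReal.ofReal ((Mmat a H t).det / m2 a H t *
              f' (1 / Real.sqrt (m1 a H t * m2 a H t)) *
              ((H t 0 0 * m2 a H t + m1 a H t * H t 1 1) /
                Real.sqrt (m1 a H t * m2 a H t) ^ 3))) < ⊤)) := by
  obtain ⟨hfmeas, hfpos, -⟩ := hf
  refine ⟨fun ⟨T, haT, hT, h⟩ =>
    hμ.lintegral_lt_top_of_lintegral_h1 hH hdiag hfmeas hfpos hfc hfm haT hT h, fun h => ?_,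
    fun f' hf' ⟨_, hf'm, hf'pos, _⟩ => ⟨?_, ?_⟩⟩
  · obtain ⟨T, haT, hT⟩ := hH.exists_between
    exact ⟨T, haT, hT,
      hμ.lintegral_schurDensity_lt_top hH hdiag hfmeas hfpos hfc hfm haT hT h⟩
  · refine exists_congr fun T => and_congr_right fun haT => and_congr_right fun hT => ?_
    exact hH.lintegral_mul_comp_lt_top_iff hdiag hfpos hf' (fun x hx => (hf'pos x hx).le) hf'm
      haT hT (hH.aemeasurable_entry haT.le hT 0 0) fun t ht =>
        hH.lintegral_h1 ht.1.le (coe_lt_of_mem_Icc hT (Ioc_subset_Icc_self ht))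
  · refine exists_congr fun T => and_congr_right fun haT => and_congr_right fun hT => ?_
    refine hH.lintegral_mul_comp_lt_top_iff hdiag hfpos hf' (fun x hx => (hf'pos x hx).le) hf'm
      haT hT (hH.aemeasurable_schurDensity haT.le hT) fun t ht => ?_
    have hb := coe_lt_of_mem_Icc hT (Ioc_subset_Icc_self ht)
    rw [Mmat_det_div (hH.m2_pos hdiag ht.1 hb).ne']
    exact hH.lintegral_schurDensity hdiag ht.1 hb

end
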